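/- arXiv:1802.03081 — 4 statements merged into one kernel-verified Lean document; each statement's English description precedes it below -/
import Mathlib

section
/- Let n ≥ 2 be an integer, let λ̂ be a real number with 1/n ≤ λ̂ < 1, and let C be a real number with C ≥ G(n, λ̂). Then the set of points θ = (θ_1,…,θ_n) ∈ ℝ^n such that 1, θ_1, …, θ_n are linearly independent over ℚ, λ̂(θ) = λ̂, and λ(θ) = C·λ̂ is infinite. -/
open scoped BigOperators ENNReal

noncomputable section

/-- Distance from a real number to the nearest integer. -/
def nint (x : ℝ) : ℝ := |x - (round x : ℝ)|

/-- `R_{n,α}(x) = x^(n-1) - (α/(1-α)) * (x^(n-2) + ⋯ + x + 1)`. -/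
def Rpoly (n : ℕ) (α : ℝ) (x : ℝ) : ℝ :=
  x ^ (n - 1) - α / (1 - α) * ∑ i ∈ Finset.range (n - 1), x ^ i

/-- Irrationality measure function for simultaneous approximation:
`ψ(t) = min { max_j ‖q θ_j‖ : q ∈ ℤ, 0 < q ≤ t }`. -/
def psi {n : ℕ} (θ : Fin n → ℝ) (t : ℝ) : ℝ :=
  sInf {v : ℝ | ∃ q : ℤ, 0 < q ∧ (q : ℝ) ≤ t ∧ v = ⨆ i : Fin n, nint ((q : ℝ) * θ i)}

/-- Ordinary exponent of simultaneous Diophantine approximation, in `[0,∞]`. -/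
def lambdaOrd {n : ℕ} (θ : Fin n → ℝ) : ℝ≥0∞ :=
  sSup {x : ℝ≥0∞ | ∃ μ : ℝ, 0 ≤ μ ∧ x = ENNReal.ofReal μ ∧
    Filter.liminf (fun t : ℝ => ENNReal.ofReal (t ^ μ * psi θ t)) Filter.atTop < ⊤}

/-- Uniform exponent of simultaneous Diophantine approximation, in `[0,∞]`. -/
def lambdaUnif {n : ℕ} (θ : Fin n → ℝ) : ℝ≥0∞ :=
  sSup {x : ℝ≥0∞ | ∃ μ : ℝ, 0 ≤ μ ∧ x = ENNReal.ofReal μ ∧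
    Filter.limsup (fun t : ℝ => ENNReal.ofReal (t ^ μ * psi θ t)) Filter.atTop < ⊤}

/-- The `c`-th coordinate of the integer sequence with `x (k + n + 1) = m k * x (k + n) + x k`
which starts with the standard basis of `ℤ ^ (n + 1)`. -/
def recSeq (n : ℕ) (m : ℕ → ℕ) (c k : ℕ) : ℤ :=
  if k ≤ n then (if k = c then 1 else 0)
  else m (k - 1 - n) * recSeq n m c (k - 1) + recSeq n m c (k - 1 - n)
termination_by k
decreasing_by all_goals omega

lemma recSeq_of_le {n : ℕ} (m : ℕ → ℕ) (c : ℕ) {k : ℕ} (hk : k ≤ n) :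
    recSeq n m c k = if k = c then 1 else 0 := by
  rw [recSeq, if_pos hk]

lemma recSeq_add (n : ℕ) (m : ℕ → ℕ) (c k : ℕ) :
    recSeq n m c (k + n + 1) = m k * recSeq n m c (k + n) + recSeq n m c k := by
  rw [recSeq, if_neg (by omega)]
  simp

/-- The integer vectors whose coordinates are given by `recSeq`. -/
def recVec (n : ℕ) (m : ℕ → ℕ) (k : ℕ) : Fin (n + 1) → ℤ := fun c => recSeq n m c k

lemma recVec_mem_span {n : ℕ} (hn : 0 < n) (m : ℕ → ℕ) (j : ℕ) (y : Fin (n + 1) → ℤ) :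
    y ∈ Submodule.span ℤ (Set.range fun i : Fin (n + 1) => recVec n m (j + i)) := by
  induction j with
  | zero =>
    have h : (fun i : Fin (n + 1) => recVec n m (0 + i)) = fun i => Pi.single i (1 : ℤ) := by
      funext i c
      rw [recVec, zero_add, recSeq_of_le m c (by omega), Pi.single_apply]
      simp [Fin.ext_iff, eq_comm]
    rw [h, Submodule.mem_span_range_iff_exists_fun]
    exact ⟨y, by ext c; simp [Finset.sum_apply, Pi.single_apply]⟩
  | succ j ih =>
    refine Submodule.span_le.2 ?_ ih
    have hmem : ∀ l, j + 1 ≤ l → l ≤ j + n + 1 → recVec n m l ∈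
        Submodule.span ℤ (Set.range fun i : Fin (n + 1) => recVec n m (j + 1 + i)) := by
      intro l h1 h2
      refine Submodule.subset_span ⟨⟨l - (j + 1), by omega⟩, ?_⟩
      simp only
      congr 1
      omega
    rintro _ ⟨i, rfl⟩
    simp only [SetLike.mem_coe]
    rcases Nat.eq_zero_or_pos (i : ℕ) with h | h
    · have : recVec n m (j + i) = recVec n m (j + n + 1) - (m j : ℤ) • recVec n m (j + n) := by
        ext c
        simp only [recVec, h, add_zero, recSeq_add, Pi.sub_apply, Pi.smul_apply, smul_eq_mul]
        ring
      rw [this]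
      exact Submodule.sub_mem _ (hmem _ (by omega) (by omega))
        (Submodule.smul_mem _ _ (hmem _ (by omega) (by omega)))
    · exact hmem _ (by omega) (by have := i.2; omega)

lemma abs_det_recVec {n : ℕ} (hn : 0 < n) (m : ℕ → ℕ) (j : ℕ) :
    |(Matrix.of fun i : Fin (n + 1) => recVec n m (j + i)).det| = 1 := by
  have h := fun i : Fin (n + 1) =>
    (Submodule.mem_span_range_iff_exists_fun ℤ).1 (recVec_mem_span hn m j (Pi.single i 1))
  choose W hW using h
  rw [← Int.isUnit_iff_abs_eq]
  refine Matrix.isUnit_det_of_left_inverse (B := Matrix.of W) ?_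
  ext i c
  have := congrFun (hW i) c
  simp only [Finset.sum_apply, Pi.smul_apply, smul_eq_mul] at this
  rw [Matrix.mul_apply, Matrix.one_apply]
  simp only [Matrix.of_apply]
  rw [this, Pi.single_apply]
  simp [eq_comm]

lemma abs_det_le {n : ℕ} (B : Matrix (Fin (n + 1)) (Fin (n + 1)) ℝ) (β : Fin (n + 1) → ℝ)
    {Q b : ℝ} (hb : 0 < b) (hβ : ∀ i, b ≤ β i) (hQ : ∀ i, |B i (Fin.last n)| ≤ Q)
    (hB : ∀ i (c : Fin n), |B i c.castSucc| ≤ β i) :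
    |B.det| * b ≤ (n + 1).factorial * (Q * ∏ i, β i) := by
  have hQ0 : 0 ≤ Q := (abs_nonneg _).trans (hQ 0)
  have hβ0 : ∀ i, 0 ≤ β i := fun i => hb.le.trans (hβ i)
  rw [Matrix.det_apply]
  refine (mul_le_mul_of_nonneg_right (Finset.abs_sum_le_sum_abs _ _) hb.le).trans ?_
  rw [Finset.sum_mul]
  refine (Finset.sum_le_card_nsmul _ _ (Q * ∏ i, β i) ?_).trans ?_
  · intro σ _
    have h1 : |Equiv.Perm.sign σ • ∏ i, B (σ i) i| = ∏ i, |B (σ i) i| := by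
      rw [← Finset.abs_prod]
      rcases Int.units_eq_one_or (Equiv.Perm.sign σ) with h | h <;> simp [h]
    rw [h1, ← Equiv.prod_comp σ β, Fin.prod_univ_castSucc, Fin.prod_univ_castSucc]
    have h2 : ∏ c : Fin n, |B (σ c.castSucc) c.castSucc| ≤ ∏ c : Fin n, β (σ c.castSucc) :=
      Finset.prod_le_prod (fun _ _ => abs_nonneg _) fun c _ => hB _ _
    have h3 : 0 ≤ ∏ c : Fin n, β (σ c.castSucc) := Finset.prod_nonneg fun c _ => hβ0 _
    calc (∏ c : Fin n, |B (σ c.castSucc) c.castSucc|) * |B (σ (Fin.last n)) (Fin.last n)| * b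
        ≤ (∏ c : Fin n, β (σ c.castSucc)) * Q * β (σ (Fin.last n)) := by
          gcongr
          · exact hQ _
          · exact hβ _
      _ = _ := by ring
  · simp [Fintype.card_perm]

/-- A maximum principle for decaying solutions of the recurrence. -/
lemma abs_le_of_recurrence {n J : ℕ} {m : ℕ → ℕ} {f L : ℕ → ℝ} {A : ℝ} (hA : 0 ≤ A)
    (hL : ∀ k, 0 < L k) (hanti : ∀ k, L (k + 1) < L k)
    (hm : ∀ k, L k ≤ ((m k : ℝ) - 1) * L (k + n)) (h0 : ∀ k < n, |f k| ≤ A * L k)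
    (hJ : f J = 0) (hrec : ∀ k, f (k + n + 1) = m k * f (k + n) + f k) :
    ∀ k ≤ J, |f k| ≤ A * L k := by
  obtain ⟨k₀, hk₀, hmax⟩ := Finset.exists_max_image (Finset.range (J + 1))
    (fun k => |f k| / L k) ⟨0, by simp⟩
  set ρ := |f k₀| / L k₀ with hρ
  have hle : ∀ k ≤ J, |f k| ≤ ρ * L k := fun k hk =>
    (div_le_iff₀ (hL k)).1 (hmax k (by simpa [Nat.lt_succ_iff] using hk))
  have heq : |f k₀| = ρ * L k₀ := by rw [hρ, div_mul_cancel₀ _ (hL k₀).ne']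
  have hρ0 : 0 ≤ ρ := div_nonneg (abs_nonneg _) (hL _).le
  suffices h : ρ ≤ A from fun k hk =>
    (hle k hk).trans (mul_le_mul_of_nonneg_right h (hL k).le)
  have hk₀' : k₀ ≤ J := by simpa [Nat.lt_succ_iff] using hk₀
  rcases lt_or_ge k₀ n with h | h
  · exact (div_le_iff₀ (hL _)).2 (h0 _ h)
  rcases hk₀'.eq_or_lt with h' | h'
  · rw [hρ, h', hJ, abs_zero, zero_div]
    exact hA
  obtain ⟨k, rfl⟩ := Nat.exists_eq_add_of_le' h
  by_contra! hlt
  have hρpos : 0 < ρ := hA.trans_lt hlt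
  have h1 : (m k : ℝ) * |f (k + n)| ≤ |f (k + n + 1)| + |f k| := by
    have : (m k : ℝ) * f (k + n) = f (k + n + 1) - f k := by rw [hrec]; ring
    rw [← abs_of_nonneg (Nat.cast_nonneg (α := ℝ) (m k)), ← abs_mul, this]
    exact abs_sub _ _
  have h2 := hle (k + n + 1) h'
  have h3 := hle k (by omega)
  rw [heq] at h1
  have h4 : ρ * (m k * L (k + n)) ≤ ρ * (L (k + n + 1) + L k) := by linarith
  have h5 := le_of_mul_le_mul_left h4 hρpos
  linarith [hanti (k + n), hm k]

lemma exists_limit {n : ℕ} {m : ℕ → ℕ} {L : ℕ → ℝ} {A : ℝ} (hA : 0 ≤ A)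
    (hL : ∀ k, 0 < L k) (hanti : ∀ k, L (k + 1) < L k)
    (hm : ∀ k, L k ≤ ((m k : ℝ) - 1) * L (k + n)) (h0 : ∀ k < n, 1 ≤ A * L k)
    (hq : ∀ k, 0 < recSeq n m n (k + n)) {c : ℕ} (hc : c < n) :
    ∃ θ : ℝ, ∀ k, |(recSeq n m c k : ℝ) - recSeq n m n k * θ| ≤ A * L k := by
  set x : ℕ → ℝ := fun J => recSeq n m c (J + n) / recSeq n m n (J + n) with hx
  have key : ∀ J, ∀ k ≤ J + n, |(recSeq n m c k : ℝ) - recSeq n m n k * x J| ≤ A * L k := by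
    intro J
    refine abs_le_of_recurrence hA hL hanti hm ?_ ?_ ?_
    · intro k hk
      rw [recSeq_of_le m c hk.le, recSeq_of_le m n hk.le, if_neg hk.ne]
      refine le_trans ?_ (h0 k hk)
      split_ifs <;> simp
    · have : (recSeq n m n (J + n) : ℝ) ≠ 0 := by exact_mod_cast (hq J).ne'
      simp only [hx]
      field_simp
      simp
    · intro k
      rw [recSeq_add, recSeq_add]
      push_cast
      ring
  have hbd : ∀ J, x J ∈ Set.Icc (-(A * L n)) (A * L n) := by
    intro J
    have := key J n (by omega)
    rw [recSeq_of_le m c le_rfl, recSeq_of_le m n le_rfl, if_neg hc.ne', if_pos rfl] at this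
    simpa [abs_le] using this
  obtain ⟨θ, -, φ, hφ, hlim⟩ := isCompact_Icc.tendsto_subseq hbd
  refine ⟨θ, fun k => ?_⟩
  have hlim' : Filter.Tendsto
      (fun i => |(recSeq n m c k : ℝ) - recSeq n m n k * (x ∘ φ) i|) Filter.atTop
      (nhds |(recSeq n m c k : ℝ) - recSeq n m n k * θ|) :=
    ((hlim.const_mul _).const_sub _).abs
  refine le_of_tendsto hlim' ?_
  filter_upwards [Filter.eventually_ge_atTop k] with i hi
  exact key _ k ((hi.trans hφ.le_apply).trans (Nat.le_add_right _ _))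

lemma nint_nonneg (x : ℝ) : 0 ≤ nint x := abs_nonneg _

lemma nint_le (x : ℝ) (p : ℤ) : nint x ≤ |x - p| := round_le x p

lemma nint_add_intCast (x : ℝ) (z : ℤ) : nint (x + z) = nint x := by
  simp [nint, round_add_intCast]

lemma psi_le {n : ℕ} [Nonempty (Fin n)] {θ : Fin n → ℝ} {t E : ℝ} {q : ℤ} (p : Fin n → ℤ)
    (hq : 0 < q) (hqt : (q : ℝ) ≤ t) (hE : ∀ i, |(p i : ℝ) - q * θ i| ≤ E) : psi θ t ≤ E := by
  have hbdd : BddBelow {v : ℝ | ∃ q : ℤ, 0 < q ∧ (q : ℝ) ≤ t ∧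
      v = ⨆ i : Fin n, nint ((q : ℝ) * θ i)} := by
    refine ⟨0, ?_⟩
    rintro _ ⟨q, -, -, rfl⟩
    exact Real.iSup_nonneg fun i => nint_nonneg _
  refine (csInf_le hbdd ⟨q, hq, hqt, rfl⟩).trans (ciSup_le fun i => ?_)
  refine (nint_le _ (p i)).trans ?_
  rw [abs_sub_comm]
  exact hE i

lemma le_psi {n : ℕ} {θ : Fin n → ℝ} {t E : ℝ} (ht : 1 ≤ t)
    (h : ∀ (q : ℤ) (p : Fin n → ℤ), 0 < q → (q : ℝ) ≤ t → ∃ i, E ≤ |(p i : ℝ) - q * θ i|) :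
    E ≤ psi θ t := by
  refine le_csInf ⟨_, 1, one_pos, by simpa using ht, rfl⟩ ?_
  rintro _ ⟨q, hq, hqt, rfl⟩
  obtain ⟨i, hi⟩ := h q (fun i => round ((q : ℝ) * θ i)) hq hqt
  rw [abs_sub_comm] at hi
  exact hi.trans (le_ciSup (f := fun i => nint ((q : ℝ) * θ i)) (Set.finite_range _).bddAbove i)

lemma psi_add_intCast {n : ℕ} (θ : Fin n → ℝ) (z : ℤ) :
    psi (fun i => θ i + z) = psi θ := by
  funext t
  unfold psi
  simp only [mul_add, ← Int.cast_mul, nint_add_intCast]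

lemma linearIndependent_of_int {n : ℕ} {θ : Fin n → ℝ}
    (h : ∀ (b : Fin n → ℤ) (b₀ : ℤ), (b₀ : ℝ) + ∑ i, b i * θ i = 0 → b = 0) :
    LinearIndependent ℚ (Fin.cons (1 : ℝ) θ : Fin (n + 1) → ℝ) := by
  rw [← LinearIndependent.iff_fractionRing ℤ ℚ, Fintype.linearIndependent_iff]
  intro g hg
  rw [Fin.sum_univ_succ] at hg
  simp only [Fin.cons_zero, Fin.cons_succ, zsmul_eq_mul, mul_one] at hg
  have h1 := h (fun i => g i.succ) (g 0) hg
  have h2 : ∀ i : Fin n, g i.succ = 0 := fun i => congrFun h1 i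
  intro i
  refine Fin.cases ?_ h2 i
  simpa [h2] using hg

lemma int_relation_of_linearIndependent {n : ℕ} {θ : Fin n → ℝ}
    (h : LinearIndependent ℚ (Fin.cons (1 : ℝ) θ : Fin (n + 1) → ℝ)) (b : Fin n → ℤ) (b₀ : ℤ)
    (hb : (b₀ : ℝ) + ∑ i, b i * θ i = 0) : b = 0 := by
  rw [← LinearIndependent.iff_fractionRing ℤ ℚ, Fintype.linearIndependent_iff] at h
  have := h (Fin.cons b₀ b) (by
    rw [Fin.sum_univ_succ]
    simpa using hb)
  funext i
  simpa using this i.succ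

lemma linearIndependent_add_intCast {n : ℕ} {θ : Fin n → ℝ}
    (h : LinearIndependent ℚ (Fin.cons (1 : ℝ) θ : Fin (n + 1) → ℝ)) (z : ℤ) :
    LinearIndependent ℚ (Fin.cons (1 : ℝ) (fun i => θ i + z) : Fin (n + 1) → ℝ) := by
  refine linearIndependent_of_int fun b b₀ hb => ?_
  refine int_relation_of_linearIndependent h b (b₀ + (∑ i, b i) * z) ?_
  rw [← hb]
  push_cast
  simp only [mul_add, Finset.sum_add_distrib, Finset.sum_mul]
  ring

lemma linearIndependent_of_recVec {n : ℕ} (hn : 0 < n) {m : ℕ → ℕ} {L : ℕ → ℝ}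
    {θ : Fin n → ℝ} (hL : Filter.Tendsto L Filter.atTop (nhds 0))
    (hθ : ∀ k (c : Fin n), |(recSeq n m c k : ℝ) - recSeq n m n k * θ c| ≤ L k) :
    LinearIndependent ℚ (Fin.cons (1 : ℝ) θ : Fin (n + 1) → ℝ) := by
  refine linearIndependent_of_int fun b b₀ hb => ?_
  set F : (Fin (n + 1) → ℤ) →ₗ[ℤ] ℤ :=
    ∑ c : Fin n, b c • LinearMap.proj c.castSucc + b₀ • LinearMap.proj (Fin.last n) with hF
  have hFapp : ∀ y, F y = ∑ c : Fin n, b c * y c.castSucc + b₀ * y (Fin.last n) := by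
    intro y
    simp [hF, LinearMap.sum_apply]
  have hbound : ∀ k, |(F (recVec n m k) : ℝ)| ≤ (∑ c, |(b c : ℝ)|) * L k := by
    intro k
    have : (F (recVec n m k) : ℝ) =
        ∑ c : Fin n, (b c : ℝ) * ((recSeq n m c k : ℝ) - recSeq n m n k * θ c) := by
      rw [hFapp]
      push_cast
      rw [eq_neg_of_add_eq_zero_left hb]
      simp only [recVec, Fin.val_castSucc, Fin.val_last]
      rw [neg_mul, Finset.sum_mul, ← sub_eq_add_neg, ← Finset.sum_sub_distrib]
      refine Finset.sum_congr rfl fun c _ => ?_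
      ring
    rw [this, Finset.sum_mul]
    refine (Finset.abs_sum_le_sum_abs _ _).trans (Finset.sum_le_sum fun c _ => ?_)
    rw [abs_mul]
    exact mul_le_mul_of_nonneg_left (hθ k c) (abs_nonneg _)
  have hlim : Filter.Tendsto (fun k => (∑ c, |(b c : ℝ)|) * L k) Filter.atTop (nhds 0) := by
    simpa using hL.const_mul (∑ c, |(b c : ℝ)|)
  obtain ⟨j, hj⟩ := Filter.eventually_atTop.1 (hlim.eventually_lt_const one_pos)
  have hzero : ∀ k ≥ j, F (recVec n m k) = 0 := by
    intro k hk
    have := (hbound k).trans_lt (hj k hk)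
    rw [← Int.abs_lt_one_iff]
    exact_mod_cast this
  have hker : ∀ y, F y = 0 := by
    intro y
    have : Submodule.span ℤ (Set.range fun i : Fin (n + 1) => recVec n m (j + i))
        ≤ LinearMap.ker F := by
      rw [Submodule.span_le]
      rintro _ ⟨i, rfl⟩
      exact hzero _ (by omega)
    exact this (recVec_mem_span hn m j y)
  funext c
  have := hker (Pi.single c.castSucc 1)
  rw [hFapp] at this
  simpa [Pi.single_apply, Fin.castSucc_inj, (Fin.castSucc_lt_last c).ne'] using this

/-- The rows `(p - q θ, q)` of an integer matrix with rows `(p, q)`. -/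
def errorMatrix {n : ℕ} (θ : Fin n → ℝ) (N : Matrix (Fin (n + 1)) (Fin (n + 1)) ℤ) :
    Matrix (Fin (n + 1)) (Fin (n + 1)) ℝ :=
  Matrix.of fun i => Fin.snoc (fun c : Fin n => (N i c.castSucc : ℝ) - N i (Fin.last n) * θ c)
    (N i (Fin.last n) : ℝ)

lemma det_errorMatrix {n : ℕ} (θ : Fin n → ℝ) (N : Matrix (Fin (n + 1)) (Fin (n + 1)) ℤ) :
    (errorMatrix θ N).det = N.det := by
  set U : Matrix (Fin (n + 1)) (Fin (n + 1)) ℝ := Matrix.of fun l c =>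
    if l = c then 1 else if l = Fin.last n then -(Fin.snoc θ 0 : Fin (n + 1) → ℝ) c else 0 with hU
  have h1 : errorMatrix θ N = N.map (Int.cast : ℤ → ℝ) * U := by
    ext i c
    rw [Matrix.mul_apply, Fin.sum_univ_castSucc]
    refine Fin.lastCases ?_ (fun c => ?_) c
    · simp [errorMatrix, hU, Fin.castSucc_ne_last]
    · simp [errorMatrix, hU, Fin.castSucc_ne_last, (Fin.castSucc_ne_last c).symm]
      ring
  have h2 : U.det = 1 := by
    rw [Matrix.det_of_isLowerTriangular]
    · simp [hU]
    · intro i j hij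
      have hij' : i < j := hij
      have : i ≠ Fin.last n := (hij'.trans_le (Fin.le_last j)).ne
      simp [hU, hij'.ne, this]
  rw [h1, Matrix.det_mul, h2, mul_one]
  exact ((Int.castRingHom ℝ).map_det N).symm

/-- Lower bound for the approximation quality of an integer point below the next term of the
sequence, in terms of a window of consecutive terms. -/
lemma exists_le_abs_sub {n : ℕ} (hn : 0 < n) {m : ℕ → ℕ} {L : ℕ → ℝ} {θ : Fin n → ℝ}
    (hL : ∀ k, 0 < L k) (hanti : StrictAnti L) (hq0 : ∀ k, 0 ≤ recSeq n m n k)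
    (hqmono : ∀ k, recSeq n m n k ≤ recSeq n m n (k + 1))
    (hθ : ∀ k (c : Fin n), |(recSeq n m c k : ℝ) - recSeq n m n k * θ c| ≤ L k)
    {τ : ℝ} (hτ0 : 0 < τ) (hτ1 : τ ≤ 1) {j : ℕ} (hgap : L (j + n) ≤ τ * L (j + n - 1))
    (hsmall : (n + 1).factorial * recSeq n m n (j + n) * τ * ∏ i ∈ Finset.range n, L (j + i) < 1)
    (q : ℤ) (p : Fin n → ℤ) (hq : 0 < q) (hqlt : q < recSeq n m n (j + n)) :
    ∃ i, τ * L (j + n - 1) ≤ |(p i : ℝ) - q * θ i| := by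
  by_contra! hE
  set y : Fin (n + 1) → ℤ := Fin.snoc p q with hy
  obtain ⟨a, ha⟩ := (Submodule.mem_span_range_iff_exists_fun ℤ).1 (recVec_mem_span hn m j y)
  set X : Matrix (Fin (n + 1)) (Fin (n + 1)) ℤ :=
    Matrix.of fun i : Fin (n + 1) => recVec n m (j + i) with hX
  have hqmono' : Monotone (recSeq n m n) := monotone_nat_of_le_succ hqmono
  have hne : ∃ i : Fin n, a i.castSucc ≠ 0 := by
    by_contra! h0
    have := congrFun ha (Fin.last n)
    rw [Fin.sum_univ_castSucc] at this
    simp only [h0, zero_smul, Finset.sum_const_zero, zero_add, Pi.smul_apply, smul_eq_mul, hy,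
      Fin.snoc_last, recVec, Fin.val_last] at this
    have hpos : 0 < recSeq n m n (j + n) := hq.trans hqlt
    have ha1 : 0 < a (Fin.last n) := by
      by_contra! h
      nlinarith
    nlinarith
  obtain ⟨i, hi⟩ := hne
  have hdetX : |X.det| = 1 := abs_det_recVec hn m j
  have hdetN : 1 ≤ |(X.updateRow i.castSucc y).det| := by
    have : X.updateRow i.castSucc y = X.updateRow i.castSucc (∑ k, a k • X k) := by
      rw [← ha]
      rfl
    rw [this, Matrix.det_updateRow_sum, smul_eq_mul, abs_mul, hdetX, mul_one]
    exact Int.one_le_abs hi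
  set B := errorMatrix θ (X.updateRow i.castSucc y) with hB
  have hdetB : 1 ≤ |B.det| := by
    rw [hB, det_errorMatrix]
    exact_mod_cast hdetN
  set γ : Fin (n + 1) → ℝ := Fin.snoc (fun c : Fin n => L (j + c)) (L (j + n - 1)) with hγ
  have hγpos : ∀ k, 0 < γ k := by
    intro k
    refine Fin.lastCases ?_ (fun k => ?_) k <;> simp [hγ, hL]
  have hγle : ∀ k, L (j + n - 1) ≤ γ k := by
    intro k
    refine Fin.lastCases ?_ (fun k => ?_) k
    · simp [hγ]
    · simp only [hγ, Fin.snoc_castSucc]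
      exact hanti.antitone (by omega)
  set β : Fin (n + 1) → ℝ := fun k =>
    (if k = i.castSucc then τ else 1) * ((if k = Fin.last n then τ else 1) * γ k) with hβ
  have hprod : ∏ k, β k = τ * (τ * (L (j + n - 1) * ∏ i ∈ Finset.range n, L (j + i))) := by
    rw [hβ, Finset.prod_mul_distrib, Finset.prod_mul_distrib, Finset.prod_ite_eq',
      Finset.prod_ite_eq', Fin.prod_univ_castSucc γ, Finset.prod_range]
    simp [hγ, mul_comm]
  have hb : 0 < τ * L (j + n - 1) := mul_pos hτ0 (hL _)
  have hbβ : ∀ k, τ * L (j + n - 1) ≤ β k := by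
    intro k
    have hk := hγle k
    have hk0 := hL (j + n - 1)
    have hne : i.castSucc ≠ Fin.last n := Fin.castSucc_ne_last i
    simp only [hβ]
    split_ifs with h1 h2
    · exact absurd (h1.symm.trans h2) hne
    · rw [one_mul]; gcongr
    · rw [one_mul]; gcongr
    · rw [one_mul, one_mul]; nlinarith
  have hQ : ∀ k, |B k (Fin.last n)| ≤ recSeq n m n (j + n) := by
    intro k
    simp only [hB, errorMatrix, Matrix.of_apply, Fin.snoc_last]
    rcases eq_or_ne k i.castSucc with rfl | hk
    · rw [Matrix.updateRow_self, hy, Fin.snoc_last, abs_of_pos (by exact_mod_cast hq)]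
      exact_mod_cast hqlt.le
    · rw [Matrix.updateRow_ne hk]
      simp only [hX, Matrix.of_apply, recVec, Fin.val_last]
      rw [abs_of_nonneg (by exact_mod_cast hq0 _)]
      exact_mod_cast hqmono' (by omega)
  have hBβ : ∀ k (c : Fin n), |B k c.castSucc| ≤ β k := by
    intro k c
    simp only [hB, errorMatrix, Matrix.of_apply, Fin.snoc_castSucc]
    rcases eq_or_ne k i.castSucc with rfl | hk
    · rw [Matrix.updateRow_self, hy, Fin.snoc_castSucc, Fin.snoc_last]
      refine (hE c).le.trans ?_
      simp only [hβ, if_pos, if_neg (Fin.castSucc_ne_last i), one_mul]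
      gcongr
      exact hγle _
    · rw [Matrix.updateRow_ne hk]
      simp only [hX, Matrix.of_apply, recVec, Fin.val_last, Fin.val_castSucc, hβ, if_neg hk,
        one_mul]
      refine (hθ _ c).trans ?_
      refine Fin.lastCases ?_ (fun k => ?_) k
      · simpa [hγ] using hgap
      · simp [hγ, Fin.castSucc_ne_last]
  have hfin := abs_det_le B β hb hbβ hQ hBβ
  rw [hprod] at hfin
  have h1 : 1 * (τ * L (j + n - 1)) ≤
      ((n + 1).factorial * recSeq n m n (j + n) * τ * ∏ i ∈ Finset.range n, L (j + i)) *
        (τ * L (j + n - 1)) := by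
    calc 1 * (τ * L (j + n - 1)) ≤ |B.det| * (τ * L (j + n - 1)) := by gcongr
      _ ≤ _ := hfin
      _ = _ := by ring
  have h2 := le_of_mul_le_mul_right h1 hb
  linarith

/-- Sum of `n` consecutive terms starting at index `j`. -/
def windowSum (n : ℕ) (M : ℕ → ℝ) (j : ℕ) : ℝ := ∑ i ∈ Finset.range n, M (j + i)

lemma windowSum_succ (n : ℕ) (M : ℕ → ℝ) (j : ℕ) :
    windowSum n M (j + 1) = windowSum n M j + (M (j + n) - M j) := by
  have h1 := Finset.sum_range_succ (fun i => M (j + i)) n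
  rw [Finset.sum_range_succ'] at h1
  simp only [windowSum]
  have : ∀ i, M (j + 1 + i) = M (j + (i + 1)) := fun i => by congr 1; ring
  simp only [this]
  simp only [add_zero] at h1
  linarith

/-- The partial quotients realising the prescribed sequence of logarithmic errors. -/
def quotient (n : ℕ) (M : ℕ → ℝ) (k : ℕ) : ℕ := ⌈Real.exp (M (k + n) - M k)⌉₊ + 1

lemma recSeq_nonneg (n : ℕ) (m : ℕ → ℕ) (c k : ℕ) : 0 ≤ recSeq n m c k := by
  induction k using Nat.strong_induction_on with
  | _ k ih =>
    rcases le_or_gt k n with h | h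
    · rw [recSeq_of_le m c h]
      split_ifs <;> simp
    · obtain ⟨l, rfl⟩ := Nat.exists_eq_add_of_lt h
      rw [show n + l + 1 = l + n + 1 by ring, recSeq_add]
      have h1 := ih (l + n) (by omega)
      have h2 := ih l (by omega)
      positivity

lemma recSeq_le_succ {n : ℕ} {m : ℕ → ℕ} (hm : ∀ k, 1 ≤ m k) (k : ℕ) :
    recSeq n m n k ≤ recSeq n m n (k + 1) := by
  rcases lt_or_ge k n with h | h
  · rw [recSeq_of_le m n h.le, if_neg h.ne]
    exact recSeq_nonneg _ _ _ _
  · obtain ⟨l, rfl⟩ := Nat.exists_eq_add_of_le' h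
    rw [recSeq_add]
    have h1 := recSeq_nonneg n m n l
    have h2 := recSeq_nonneg n m n (l + n)
    have h3 : (1 : ℤ) ≤ m l := by exact_mod_cast hm l
    nlinarith

lemma recSeq_quotient_bounds {n : ℕ} {M : ℕ → ℝ} (hM : Monotone M) (j : ℕ) :
    Real.exp (windowSum n M j - windowSum n M 0) ≤ recSeq n (quotient n M) n (j + n) ∧
    (recSeq n (quotient n M) n (j + n) : ℝ) ≤
      4 ^ j * Real.exp (windowSum n M j - windowSum n M 0) := by
  induction j with
  | zero => simp [recSeq_of_le]
  | succ j ih =>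
    set q := recSeq n (quotient n M) n with hq
    have h1 : (0 : ℝ) ≤ q j := by exact_mod_cast recSeq_nonneg _ _ _ _
    have h2 : (q j : ℝ) ≤ q (j + n) := by
      exact_mod_cast monotone_nat_of_le_succ
        (recSeq_le_succ (fun k => Nat.le_add_left 1 _)) (Nat.le_add_right j n)
    have h3 : (q (j + 1 + n) : ℝ) = quotient n M j * q (j + n) + q j := by
      rw [show j + 1 + n = j + n + 1 by ring, hq, recSeq_add]
      push_cast
      rfl
    have h4 : windowSum n M (j + 1) - windowSum n M 0 =
        (M (j + n) - M j) + (windowSum n M j - windowSum n M 0) := by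
      rw [windowSum_succ]; ring
    set e := Real.exp (M (j + n) - M j) with he
    have he1 : 1 ≤ e := Real.one_le_exp (sub_nonneg.2 (hM (Nat.le_add_right j n)))
    have h5 : e ≤ ⌈e⌉₊ := Nat.le_ceil _
    have h6 : (⌈e⌉₊ : ℝ) < e + 1 := Nat.ceil_lt_add_one (by linarith)
    have h7 : (quotient n M j : ℝ) = ⌈e⌉₊ + 1 := by simp [quotient, he]
    rw [h4, Real.exp_add, h3, h7]
    set w := Real.exp (windowSum n M j - windowSum n M 0) with hw
    have hw0 : 0 < w := Real.exp_pos _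
    obtain ⟨ih1, ih2⟩ := ih
    constructor
    · nlinarith [mul_le_mul h5 ih1 hw0.le (by linarith)]
    · calc ((⌈e⌉₊ : ℝ) + 1) * q (j + n) + q j ≤ (e + 2) * q (j + n) + q (j + n) := by
            have : (0 : ℝ) ≤ q (j + n) := h1.trans h2
            exact add_le_add (mul_le_mul_of_nonneg_right (by linarith) this) h2
        _ ≤ (4 * e) * q (j + n) := by
            have : (0 : ℝ) ≤ q (j + n) := h1.trans h2
            nlinarith
        _ ≤ (4 * e) * (4 ^ j * w) := by gcongr
        _ = _ := by ring

/-- Existence of a point with prescribed logarithmic sizes of its best approximations. -/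
theorem exists_point_of_profile {n : ℕ} (hn : 0 < n) {M : ℕ → ℝ} (hM0 : 0 ≤ M 0)
    (hM : StrictMono M) (hMtop : Filter.Tendsto M Filter.atTop Filter.atTop)
    (hgap : Filter.Tendsto (fun j => Real.exp (M (j + 1) - M j) / 4 ^ j)
      Filter.atTop Filter.atTop) :
    ∃ (θ : Fin n → ℝ) (q : ℕ → ℝ) (A δ : ℝ), 0 < A ∧ 0 < δ ∧
      LinearIndependent ℚ (Fin.cons (1 : ℝ) θ : Fin (n + 1) → ℝ) ∧
      q 0 = 1 ∧ (∀ j, 2 * q j ≤ q (j + 1)) ∧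
      (∀ j, Real.exp (windowSum n M j - windowSum n M 0) ≤ q j) ∧
      (∀ j, q j ≤ 4 ^ j * Real.exp (windowSum n M j)) ∧
      (∀ j t, q j ≤ t → psi θ t ≤ A * Real.exp (-M (j + n))) ∧
      ∀ᶠ j in Filter.atTop, ∀ t, 1 ≤ t → t < q (j + 1) →
        δ / 4 ^ j * Real.exp (-M (j + n)) ≤ psi θ t := by
  have hne : Nonempty (Fin n) := ⟨⟨0, hn⟩⟩
  set m := quotient n M with hm
  have hm1 : ∀ k, 1 ≤ m k := fun k => Nat.le_add_left 1 _
  have hmexp : ∀ k, Real.exp (M (k + n) - M k) ≤ (m k : ℝ) - 1 := by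
    intro k
    simp only [hm, quotient, Nat.cast_add, Nat.cast_one, add_sub_cancel_right]
    exact Nat.le_ceil _
  have hbounds := recSeq_quotient_bounds (n := n) hM.monotone
  rw [← hm] at hbounds
  have hqpos : ∀ k, 0 < recSeq n m n (k + n) := by
    intro k
    exact_mod_cast (Real.exp_pos _).trans_le (hbounds k).1
  set A := Real.exp (M n) with hA
  have hApos : 0 < A := Real.exp_pos _
  have hθ : ∀ c : Fin n, ∃ θ : ℝ, ∀ k,
      |(recSeq n m c k : ℝ) - recSeq n m n k * θ| ≤ A * Real.exp (-M k) := by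
    intro c
    refine exists_limit hApos.le (fun k => Real.exp_pos _) (fun k => ?_) (fun k => ?_)
      (fun k hk => ?_) hqpos c.2
    · exact Real.exp_lt_exp.2 (neg_lt_neg (hM k.lt_succ_self))
    · refine le_trans ?_ (mul_le_mul_of_nonneg_right (hmexp k) (Real.exp_pos _).le)
      rw [← Real.exp_add]
      apply le_of_eq
      congr 1
      ring
    · rw [hA, ← Real.exp_add]
      exact Real.one_le_exp (by linarith [hM.monotone hk.le])
  choose θ hθ using hθ
  have hT0 : 0 ≤ windowSum n M 0 :=
    Finset.sum_nonneg fun i _ => hM0.trans (hM.monotone (Nat.zero_le _))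
  have hupper : ∀ j, (recSeq n m n (j + n) : ℝ) ≤ 4 ^ j * Real.exp (windowSum n M j) := by
    intro j
    refine (hbounds j).2.trans ?_
    gcongr
    linarith
  refine ⟨θ, fun j => recSeq n m n (j + n), A, A / (8 * (n + 1).factorial * A ^ n), hApos,
    by positivity, ?_, ?_, ?_, fun j => (hbounds j).1, hupper, ?_, ?_⟩
  · refine linearIndependent_of_recVec hn (L := fun k => A * Real.exp (-M k)) ?_
      fun k c => hθ c k
    have := (Real.tendsto_exp_neg_atTop_nhds_zero.comp hMtop).const_mul A
    simpa using this
  · simp [recSeq_of_le]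
  · intro j
    have h1 := recSeq_nonneg n m n j
    have h2 : (2 : ℝ) ≤ m j := by
      have := hmexp j
      have h3 := Real.one_le_exp (sub_nonneg.2 (hM.monotone (Nat.le_add_right j n)))
      linarith
    have h4 : (2 : ℤ) ≤ m j := by exact_mod_cast h2
    have h5 := hqpos j
    have : 2 * recSeq n m n (j + n) ≤ recSeq n m n (j + 1 + n) := by
      rw [show j + 1 + n = j + n + 1 by ring, recSeq_add]
      nlinarith
    beta_reduce
    exact_mod_cast this
  · intro j t ht
    exact psi_le (fun i => recSeq n m i (j + n)) (hqpos j) ht fun i => hθ i _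
  · set K : ℝ := 8 * (n + 1).factorial * A ^ n with hK
    have hKpos : 0 < K := by positivity
    have hK1 : 1 ≤ K := by
      have h1 : (1 : ℝ) ≤ (n + 1).factorial := by exact_mod_cast Nat.factorial_pos _
      have h2 : 1 ≤ A ^ n := one_le_pow₀ (Real.one_le_exp (hM0.trans (hM.monotone n.zero_le)))
      nlinarith
    filter_upwards [(hgap.comp (Filter.tendsto_add_atTop_nat n)).eventually_ge_atTop K]
      with j hj t ht1 ht
    simp only [Function.comp_apply] at hj
    have h4 : (1 : ℝ) ≤ 4 ^ j := one_le_pow₀ (by norm_num)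
    have hexp : K * 4 ^ j ≤ Real.exp (M (j + n + 1) - M (j + n)) := by
      rw [le_div_iff₀ (by positivity)] at hj
      refine le_trans ?_ hj
      gcongr
      · norm_num
      · omega
    refine le_psi ht1 fun q p hq hqt => ?_
    have hstep : A * Real.exp (-M (j + 1 + n)) ≤
        1 / (K * 4 ^ j) * (A * Real.exp (-M (j + 1 + n - 1))) := by
      rw [show j + 1 + n - 1 = j + n by omega, show j + 1 + n = j + n + 1 by ring,
        one_div_mul_eq_div, le_div_iff₀ (by positivity), mul_assoc]
      refine mul_le_mul_of_nonneg_left ?_ hApos.le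
      calc Real.exp (-M (j + n + 1)) * (K * 4 ^ j)
          ≤ Real.exp (-M (j + n + 1)) * Real.exp (M (j + n + 1) - M (j + n)) := by gcongr
        _ = Real.exp (-M (j + n)) := by rw [← Real.exp_add]; congr 1; ring
    have hsmall : (n + 1).factorial * recSeq n m n (j + 1 + n) * (1 / (K * 4 ^ j)) *
        ∏ i ∈ Finset.range n, A * Real.exp (-M (j + 1 + i)) < 1 := by
      have hprod : ∏ i ∈ Finset.range n, A * Real.exp (-M (j + 1 + i)) =
          A ^ n * Real.exp (-windowSum n M (j + 1)) := by
        rw [Finset.prod_mul_distrib, Finset.prod_const, Finset.card_range, ← Real.exp_sum,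
          Finset.sum_neg_distrib, windowSum]
      rw [hprod]
      have hu := hupper (j + 1)
      calc ((n + 1).factorial : ℝ) * recSeq n m n (j + 1 + n) * (1 / (K * 4 ^ j)) *
            (A ^ n * Real.exp (-windowSum n M (j + 1)))
          ≤ (n + 1).factorial * (4 ^ (j + 1) * Real.exp (windowSum n M (j + 1))) *
            (1 / (K * 4 ^ j)) * (A ^ n * Real.exp (-windowSum n M (j + 1))) := by gcongr
        _ = 1 / 2 := by
            rw [Real.exp_neg, hK, pow_succ]
            field_simp
            norm_num
        _ < 1 := by norm_num
    obtain ⟨i, hi⟩ := exists_le_abs_sub (j := j + 1) (τ := 1 / (K * 4 ^ j)) hn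
      (L := fun k => A * Real.exp (-M k)) (θ := θ) (fun k => mul_pos hApos (Real.exp_pos _))
      (fun a b hab => mul_lt_mul_of_pos_left (Real.exp_lt_exp.2 (neg_lt_neg (hM hab))) hApos)
      (recSeq_nonneg n m n) (recSeq_le_succ hm1) (fun k c => hθ c k) (by positivity)
      (by rw [div_le_one (by positivity)]; exact one_le_mul_of_one_le_of_one_le hK1 h4)
      hstep hsmall q p hq (by exact_mod_cast hqt.trans_lt ht)
    refine ⟨i, le_trans (le_of_eq ?_) hi⟩
    rw [show j + 1 + n - 1 = j + n by omega]
    field_simp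

lemma lambdaUnif_eq {n : ℕ} {θ : Fin n → ℝ} {α : ℝ}
    (h1 : ∀ μ, 0 ≤ μ → μ < α → ∃ K, ∀ᶠ t in Filter.atTop, t ^ μ * psi θ t ≤ K)
    (h2 : ∀ μ, α < μ → ∀ K, ∃ᶠ t in Filter.atTop, K ≤ t ^ μ * psi θ t) :
    lambdaUnif θ = ENNReal.ofReal α := by
  apply le_antisymm
  · refine sSup_le ?_
    rintro _ ⟨μ, -, rfl, hlim⟩
    refine ENNReal.ofReal_le_ofReal ?_
    by_contra! hμ
    obtain ⟨K, hK, -⟩ := ENNReal.lt_iff_exists_nnreal_btwn.1 hlim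
    obtain ⟨t, ht, ht'⟩ :=
      ((h2 μ hμ K).and_eventually (Filter.eventually_lt_of_limsup_lt hK)).exists
    refine absurd ht' (not_lt.2 ?_)
    rw [← ENNReal.ofReal_coe_nnreal]
    exact ENNReal.ofReal_le_ofReal ht
  · refine le_of_forall_lt fun c hc => ?_
    have hc' : c.toReal < α := (ENNReal.lt_ofReal_iff_toReal_lt hc.ne_top).1 hc
    obtain ⟨μ, hcμ, hμα⟩ := exists_between hc'
    have hμ0 : 0 ≤ μ := ENNReal.toReal_nonneg.trans hcμ.le
    refine lt_of_lt_of_le ((ENNReal.lt_ofReal_iff_toReal_lt hc.ne_top).2 hcμ)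
      (le_sSup ⟨μ, hμ0, rfl, ?_⟩)
    obtain ⟨K, hK⟩ := h1 μ hμ0 hμα
    refine (Filter.limsup_le_of_le (a := ENNReal.ofReal K) ?_ ?_).trans_lt ENNReal.ofReal_lt_top
    · isBoundedDefault
    · exact hK.mono fun t ht => ENNReal.ofReal_le_ofReal ht

lemma lambdaOrd_eq {n : ℕ} {θ : Fin n → ℝ} {β : ℝ}
    (h1 : ∀ μ, 0 ≤ μ → μ < β → ∃ K, ∃ᶠ t in Filter.atTop, t ^ μ * psi θ t ≤ K)
    (h2 : ∀ μ, β < μ → ∀ K, ∀ᶠ t in Filter.atTop, K ≤ t ^ μ * psi θ t) :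
    lambdaOrd θ = ENNReal.ofReal β := by
  apply le_antisymm
  · refine sSup_le ?_
    rintro _ ⟨μ, -, rfl, hlim⟩
    refine ENNReal.ofReal_le_ofReal ?_
    by_contra! hμ
    obtain ⟨K, hK, -⟩ := ENNReal.lt_iff_exists_nnreal_btwn.1 hlim
    have hfr := Filter.frequently_lt_of_liminf_lt (by isBoundedDefault) hK
    obtain ⟨t, ht', ht⟩ := (hfr.and_eventually (h2 μ hμ K)).exists
    refine absurd ht' (not_lt.2 ?_)
    rw [← ENNReal.ofReal_coe_nnreal]
    exact ENNReal.ofReal_le_ofReal ht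
  · refine le_of_forall_lt fun c hc => ?_
    have hc' : c.toReal < β := (ENNReal.lt_ofReal_iff_toReal_lt hc.ne_top).1 hc
    obtain ⟨μ, hcμ, hμα⟩ := exists_between hc'
    have hμ0 : 0 ≤ μ := ENNReal.toReal_nonneg.trans hcμ.le
    refine lt_of_lt_of_le ((ENNReal.lt_ofReal_iff_toReal_lt hc.ne_top).2 hcμ)
      (le_sSup ⟨μ, hμ0, rfl, ?_⟩)
    obtain ⟨K, hK⟩ := h1 μ hμ0 hμα
    refine (Filter.liminf_le_of_frequently_le (a := ENNReal.ofReal K) ?_).trans_lt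
      ENNReal.ofReal_lt_top
    exact hK.mono fun t ht => ENNReal.ofReal_le_ofReal ht

/-- Exponents of a point whose irrationality measure function is controlled by a profile:
`log (q j)` is close to `T j` and `- log ψ` is close to `N j` between `q j` and `q (j + 1)`. -/
lemma exponents_eq {n : ℕ} {θ : Fin n → ℝ} {q T N : ℕ → ℝ} {A δ α β T₀ : ℝ} (hA : 0 < A)
    (hδ : 0 < δ) (hα : 0 ≤ α) (hβ : 0 ≤ β) (hq0 : q 0 = 1) (hqs : ∀ j, 2 * q j ≤ q (j + 1))
    (hql : ∀ j, Real.exp (T j - T₀) ≤ q j) (hqu : ∀ j, q j ≤ 4 ^ j * Real.exp (T j))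
    (hψu : ∀ j t, q j ≤ t → psi θ t ≤ A * Real.exp (-N j))
    (hψl : ∀ᶠ j in Filter.atTop, ∀ t, 1 ≤ t → t < q (j + 1) →
      δ / 4 ^ j * Real.exp (-N j) ≤ psi θ t)
    (hT : ∀ j : ℕ, (j : ℝ) ^ 2 ≤ T j)
    (hα1 : ∀ j, α * T (j + 1) ≤ N j)
    (hα2 : ∀ ε > 0, ∃ᶠ j in Filter.atTop, N j ≤ (α + ε) * T (j + 1))
    (hβ1 : ∀ ε > 0, ∀ᶠ j in Filter.atTop, N j ≤ (β + ε) * T j)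
    (hβ2 : ∃ᶠ j in Filter.atTop, β * T j ≤ N j) :
    lambdaUnif θ = ENNReal.ofReal α ∧ lambdaOrd θ = ENNReal.ofReal β := by
  set l := Real.log 4 with hl
  have hl0 : 0 < l := Real.log_pos (by norm_num)
  have h4 : ∀ j : ℕ, (4 : ℝ) ^ j = Real.exp (j * l) := by
    intro j
    rw [mul_comm, Real.exp_mul, hl, Real.exp_log (by norm_num), Real.rpow_natCast]
  have hlin : ∀ ε > 0, ∃ K, ∀ j : ℕ, j * l ≤ ε * T j + K := by
    intro ε hε
    refine ⟨l ^ 2 / (4 * ε), fun j => ?_⟩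
    have h1 : (j : ℝ) * l ≤ ε * j ^ 2 + l ^ 2 / (4 * ε) := by
      rw [← sub_nonneg]
      have : ε * j ^ 2 + l ^ 2 / (4 * ε) - j * l = (2 * ε * j - l) ^ 2 / (4 * ε) := by
        field_simp
        ring
      rw [this]
      positivity
    linarith [mul_le_mul_of_nonneg_left (hT j) hε.le]
  have hTtop : Filter.Tendsto T Filter.atTop Filter.atTop :=
    Filter.tendsto_atTop_mono hT
      ((Filter.tendsto_pow_atTop two_ne_zero).comp tendsto_natCast_atTop_atTop)
  have hqpos : ∀ j, 0 < q j := fun j => (Real.exp_pos _).trans_le (hql j)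
  have hqmono : StrictMono q := strictMono_nat_of_lt_succ fun j => by linarith [hqs j, hqpos j]
  have hq1 : ∀ j, 1 ≤ q j := fun j => hq0 ▸ hqmono.monotone (Nat.zero_le j)
  have hqtop : Filter.Tendsto q Filter.atTop Filter.atTop :=
    Filter.tendsto_atTop_mono hql
      (Real.tendsto_exp_atTop.comp (Filter.tendsto_atTop_add_const_right _ _ hTtop))
  have hloc : ∀ j₀ t, q j₀ ≤ t → ∃ j ≥ j₀, q j ≤ t ∧ t < q (j + 1) := by
    intro j₀ t ht
    have hex : ∃ j, t < q j := (hqtop.eventually_gt_atTop t).exists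
    classical
    have hgt : j₀ < Nat.find hex := by
      by_contra! h
      exact absurd (Nat.find_spec hex) (not_lt.2 ((hqmono.monotone h).trans ht))
    refine ⟨Nat.find hex - 1, by omega, not_lt.1 (Nat.find_min hex (by omega)), ?_⟩
    rw [show Nat.find hex - 1 + 1 = Nat.find hex by omega]
    exact Nat.find_spec hex
  have hqpu : ∀ j μ, 0 ≤ μ → q j ^ μ ≤ Real.exp (μ * (j * l + T j)) := by
    intro j μ hμ
    calc q j ^ μ ≤ (Real.exp (j * l + T j)) ^ μ := by
          refine Real.rpow_le_rpow (hqpos j).le ?_ hμ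
          rw [Real.exp_add, ← h4]
          exact hqu j
      _ = _ := by rw [← Real.exp_mul, mul_comm]
  have hqpl : ∀ j μ, 0 ≤ μ → Real.exp (μ * (T j - T₀)) ≤ q j ^ μ := by
    intro j μ hμ
    calc Real.exp (μ * (T j - T₀)) = (Real.exp (T j - T₀)) ^ μ := by
          rw [← Real.exp_mul, mul_comm]
      _ ≤ _ := Real.rpow_le_rpow (Real.exp_pos _).le (hql j) hμ
  have hup : ∀ ν μ, 0 ≤ μ → μ < ν → ∃ K, ∀ j i : ℕ, ν * T j ≤ N i → ∀ t, q i ≤ t → t ≤ q j →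
      t ^ μ * psi θ t ≤ K := by
    intro ν μ hμ0 hμ
    obtain ⟨K, hK⟩ := hlin ((ν - μ) / (μ + 1)) (div_pos (by linarith) (by linarith))
    refine ⟨Real.exp (μ * K) * A, fun j i hN t hit htj => ?_⟩
    have ht0 : 0 ≤ t := (hqpos i).le.trans hit
    have hTj : 0 ≤ T j := (sq_nonneg _).trans (hT j)
    calc t ^ μ * psi θ t ≤ q j ^ μ * (A * Real.exp (-N i)) := by
          refine (mul_le_mul_of_nonneg_left (hψu i t hit) (Real.rpow_nonneg ht0 _)).trans ?_
          exact mul_le_mul_of_nonneg_right (Real.rpow_le_rpow ht0 htj hμ0) (by positivity)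
      _ ≤ Real.exp (μ * (j * l + T j)) * (A * Real.exp (-(ν * T j))) := by
          gcongr
          exact hqpu j μ hμ0
      _ = Real.exp (μ * (j * l + T j) + -(ν * T j)) * A := by rw [Real.exp_add]; ring
      _ ≤ _ := by
          gcongr
          have h1 := mul_le_mul_of_nonneg_left (hK j) hμ0
          have h2 : μ * ((ν - μ) / (μ + 1) * T j) ≤ (ν - μ) * T j := by
            rw [← mul_assoc]
            refine mul_le_mul_of_nonneg_right ?_ hTj
            rw [mul_div_assoc', div_le_iff₀ (by linarith)]
            nlinarith
          nlinarith
  refine ⟨lambdaUnif_eq ?_ ?_, lambdaOrd_eq ?_ ?_⟩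
  · intro μ hμ0 hμ
    obtain ⟨K, hK⟩ := hup α μ hμ0 hμ
    refine ⟨K, ?_⟩
    filter_upwards [Filter.eventually_ge_atTop (q 0)] with t ht
    obtain ⟨j, -, hj1, hj2⟩ := hloc 0 t ht
    exact hK (j + 1) j (hα1 j) t hj1 hj2.le
  · intro μ hμ K
    have hμ0 : 0 ≤ μ := hα.trans hμ.le
    set ε := (μ - α) / 3 with hε
    have hεpos : 0 < ε := by rw [hε]; linarith
    obtain ⟨K', hK'⟩ := hlin ε hεpos
    have hbig : Filter.Tendsto (fun j => δ * 2⁻¹ ^ μ * Real.exp (ε * T (j + 1) - K' - μ * T₀))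
        Filter.atTop Filter.atTop := by
      refine Filter.Tendsto.const_mul_atTop (by positivity) (Real.tendsto_exp_atTop.comp ?_)
      refine Filter.tendsto_atTop_add_const_right _ _ (Filter.tendsto_atTop_add_const_right _ _ ?_)
      exact ((Filter.tendsto_add_atTop_iff_nat 1).2 hTtop).const_mul_atTop hεpos
    rw [Filter.frequently_atTop]
    intro a
    obtain ⟨j, hN, hj1, hj2, hj3⟩ := ((hα2 ε hεpos).and_eventually
      (hψl.and ((hbig.eventually_ge_atTop K).and (hqtop.eventually_ge_atTop a)))).exists
    have hhalf : q j ≤ q (j + 1) / 2 := by linarith [hqs j]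
    refine ⟨q (j + 1) / 2, hj3.trans hhalf, hj2.trans ?_⟩
    have hψ := hj1 (q (j + 1) / 2) ((hq1 j).trans hhalf) (by linarith [hqpos (j + 1)])
    have hTj : 0 ≤ T (j + 1) := (sq_nonneg _).trans (hT _)
    calc δ * 2⁻¹ ^ μ * Real.exp (ε * T (j + 1) - K' - μ * T₀)
        ≤ δ * 2⁻¹ ^ μ * Real.exp (μ * (T (j + 1) - T₀) + (-(j * l) + -N j)) := by
          gcongr
          have h1 := hK' (j + 1)
          push_cast at h1
          have h2 : μ = α + 3 * ε := by rw [hε]; ring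
          have h3 : μ * T (j + 1) = (α + ε) * T (j + 1) + 2 * (ε * T (j + 1)) := by
            rw [h2]; ring
          nlinarith
      _ = Real.exp (μ * (T (j + 1) - T₀)) * 2⁻¹ ^ μ * (δ / 4 ^ j * Real.exp (-N j)) := by
          rw [Real.exp_add, Real.exp_add, Real.exp_neg (j * l), ← h4]
          ring
      _ ≤ q (j + 1) ^ μ * 2⁻¹ ^ μ * psi θ (q (j + 1) / 2) := by
          gcongr
          · exact mul_nonneg (Real.rpow_nonneg (hqpos _).le _) (by positivity)
          · exact hqpl _ _ hμ0
      _ = _ := by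
          rw [div_eq_mul_inv, Real.mul_rpow (hqpos _).le (by norm_num)]
  · intro μ hμ0 hμ
    obtain ⟨K, hK⟩ := hup β μ hμ0 hμ
    refine ⟨K, ?_⟩
    rw [Filter.frequently_atTop]
    intro a
    obtain ⟨j, hN, hj⟩ := (hβ2.and_eventually (hqtop.eventually_ge_atTop a)).exists
    exact ⟨q j, hj, hK j j hN (q j) le_rfl le_rfl⟩
  · intro μ hμ K
    have hμ0 : 0 ≤ μ := hβ.trans hμ.le
    set ε := (μ - β) / 3 with hε
    have hεpos : 0 < ε := by rw [hε]; linarith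
    obtain ⟨K', hK'⟩ := hlin ε hεpos
    have hbig : Filter.Tendsto (fun j => δ * Real.exp (ε * T j - K' - μ * T₀))
        Filter.atTop Filter.atTop := by
      refine Filter.Tendsto.const_mul_atTop hδ (Real.tendsto_exp_atTop.comp ?_)
      refine Filter.tendsto_atTop_add_const_right _ _ (Filter.tendsto_atTop_add_const_right _ _ ?_)
      exact hTtop.const_mul_atTop hεpos
    obtain ⟨j₀, hj₀⟩ := Filter.eventually_atTop.1
      ((hβ1 ε hεpos).and (hψl.and (hbig.eventually_ge_atTop K)))
    filter_upwards [Filter.eventually_ge_atTop (q j₀)] with t ht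
    obtain ⟨j, hj, hjt, htj⟩ := hloc j₀ t ht
    obtain ⟨hN, hψ, hK⟩ := hj₀ j hj
    refine hK.trans ?_
    have hψt := hψ t ((hq1 j).trans hjt) htj
    calc δ * Real.exp (ε * T j - K' - μ * T₀)
        ≤ δ * Real.exp (μ * (T j - T₀) + (-(j * l) + -N j)) := by
          gcongr
          have h1 := hK' j
          have h2 : μ = β + 3 * ε := by rw [hε]; ring
          have h3 : μ * T j = (β + ε) * T j + 2 * (ε * T j) := by rw [h2]; ring
          have : 0 ≤ ε * T j := mul_nonneg hεpos.le ((sq_nonneg _).trans (hT _))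
          nlinarith
      _ = Real.exp (μ * (T j - T₀)) * (δ / 4 ^ j * Real.exp (-N j)) := by
          rw [Real.exp_add, Real.exp_add, Real.exp_neg (j * l), ← h4]
          ring
      _ ≤ t ^ μ * psi θ t := by
          gcongr
          · exact Real.rpow_nonneg ((hqpos j).le.trans hjt) _
          · exact (hqpl j μ hμ0).trans (Real.rpow_le_rpow (hqpos j).le hjt hμ0)

/-- The profile of logarithmic errors: consecutive ratios are asymptotically `g`, except that
every `n`-th one is `g * D`. -/
def profile (n : ℕ) (g D : ℝ) (k : ℕ) : ℝ := ((k : ℝ) + 1) ^ 2 * (g ^ k * D ^ (k / n))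

lemma profile_zero (n : ℕ) (g D : ℝ) : profile n g D 0 = 1 := by simp [profile]

lemma add_le_profile_succ {n : ℕ} {g D : ℝ} (hg : 1 ≤ g) (hD : 1 ≤ D) (k : ℕ) :
    profile n g D k + (2 * k + 3) ≤ profile n g D (k + 1) := by
  have h1 : 1 ≤ g ^ k * D ^ (k / n) :=
    one_le_mul_of_one_le_of_one_le (one_le_pow₀ hg) (one_le_pow₀ hD)
  have h2 : g ^ k * D ^ (k / n) ≤ g ^ (k + 1) * D ^ ((k + 1) / n) := by
    gcongr <;> first | assumption | omega
  simp only [profile]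
  push_cast
  nlinarith [mul_le_mul_of_nonneg_left h2 (sq_nonneg ((k : ℝ) + 1 + 1)),
    (Nat.cast_nonneg k : (0 : ℝ) ≤ k)]

lemma sq_le_profile {n : ℕ} {g D : ℝ} (hg : 1 ≤ g) (hD : 1 ≤ D) (k : ℕ) :
    ((k : ℝ) + 1) ^ 2 ≤ profile n g D k :=
  le_mul_of_one_le_right (sq_nonneg _)
    (one_le_mul_of_one_le_of_one_le (one_le_pow₀ hg) (one_le_pow₀ hD))

lemma tendsto_exp_profile_gap {n : ℕ} {g D : ℝ} (hg : 1 ≤ g) (hD : 1 ≤ D) :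
    Filter.Tendsto (fun j => Real.exp (profile n g D (j + 1) - profile n g D j) / 4 ^ j)
      Filter.atTop Filter.atTop := by
  have he : 1 < Real.exp 2 / 4 := by
    have h1 := Real.add_one_le_exp (1 : ℝ)
    have h2 : Real.exp 2 = Real.exp 1 ^ 2 := by rw [← Real.exp_nat_mul]; norm_num
    have h3 := Real.exp_one_gt_d9
    rw [h2, lt_div_iff₀ (by norm_num)]
    nlinarith
  refine Filter.tendsto_atTop_mono (fun j => ?_) (tendsto_pow_atTop_atTop_of_one_lt he)
  rw [div_pow]
  gcongr
  rw [← Real.exp_nat_mul]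
  gcongr
  linarith [add_le_profile_succ (n := n) hg hD j]

lemma windowSum_profile_le {n : ℕ} {g D : ℝ} (hg : 1 ≤ g) (hD : 1 ≤ D) {j e w : ℕ}
    (he : ∀ i < n, (j + i) / n ≤ e) (hw : j + n ≤ w + 1) :
    windowSum n (profile n g D) j ≤
      ((w : ℝ) + 1) ^ 2 * (g ^ j * D ^ e) * ∑ i ∈ Finset.range n, g ^ i := by
  rw [Finset.mul_sum]
  refine Finset.sum_le_sum fun i hi => ?_
  have hi := Finset.mem_range.1 hi
  simp only [profile, pow_add]
  calc (((j + i : ℕ) : ℝ) + 1) ^ 2 * (g ^ j * g ^ i * D ^ ((j + i) / n))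
      ≤ ((w : ℝ) + 1) ^ 2 * (g ^ j * g ^ i * D ^ e) := by
        gcongr
        · omega
        · exact he i hi
    _ = _ := by ring

lemma le_windowSum_profile {n : ℕ} {g D : ℝ} (hg : 1 ≤ g) (hD : 1 ≤ D) {j e w : ℕ}
    (he : ∀ i < n, e ≤ (j + i) / n) (hw : w ≤ j) :
    ((w : ℝ) + 1) ^ 2 * (g ^ j * D ^ e) * ∑ i ∈ Finset.range n, g ^ i ≤
      windowSum n (profile n g D) j := by
  rw [Finset.mul_sum]
  refine Finset.sum_le_sum fun i hi => ?_
  have hi := Finset.mem_range.1 hi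
  simp only [profile, pow_add]
  calc ((w : ℝ) + 1) ^ 2 * (g ^ j * D ^ e) * g ^ i
      = ((w : ℝ) + 1) ^ 2 * (g ^ j * g ^ i * D ^ e) := by ring
    _ ≤ (((j + i : ℕ) : ℝ) + 1) ^ 2 * (g ^ j * g ^ i * D ^ ((j + i) / n)) := by
        gcongr
        · omega
        · exact he i hi

lemma eventually_mul_sq_le (n : ℕ) (β : ℝ) {ε : ℝ} (hε : 0 < ε) :
    ∀ᶠ j : ℕ in Filter.atTop,
      β * (((j + n : ℕ) : ℝ) + 1) ^ 2 ≤ (β + ε) * ((j : ℝ) + 1) ^ 2 := by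
  have h : Filter.Tendsto (fun j : ℕ => β * (1 + n * (1 / ((j : ℝ) + 1))) ^ 2) Filter.atTop
      (nhds (β * (1 + n * 0) ^ 2)) :=
    (((tendsto_one_div_add_atTop_nhds_zero_nat.const_mul _).const_add _).pow _).const_mul _
  have hlt : β * (1 + n * 0) ^ 2 < β + ε := by simpa using hε
  filter_upwards [h.eventually_lt_const hlt] with j hj
  have hj0 : (0 : ℝ) < (j : ℝ) + 1 := by positivity
  calc β * (((j + n : ℕ) : ℝ) + 1) ^ 2
      = β * (1 + n * (1 / ((j : ℝ) + 1))) ^ 2 * ((j : ℝ) + 1) ^ 2 := by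
        push_cast
        field_simp
        ring
    _ ≤ _ := by gcongr

lemma one_le_of_Rpoly_root {n : ℕ} (hn : 2 ≤ n) {α g : ℝ} (hα1 : 1 / (n : ℝ) ≤ α) (hα2 : α < 1)
    (hg : 0 < g) (hroot : Rpoly n α g = 0) : 1 ≤ g := by
  by_contra! hlt
  have hn' : (2 : ℝ) ≤ n := by exact_mod_cast hn
  have hsum : ((n : ℝ) - 1) * g ^ (n - 1) < ∑ i ∈ Finset.range (n - 1), g ^ i := by
    calc ((n : ℝ) - 1) * g ^ (n - 1) = ∑ i ∈ Finset.range (n - 1), g ^ (n - 1) := by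
          rw [Finset.sum_const, Finset.card_range, nsmul_eq_mul, Nat.cast_sub (by omega)]
          simp
      _ < _ := by
          refine Finset.sum_lt_sum_of_nonempty ⟨0, by simp; omega⟩ fun i hi => ?_
          exact pow_lt_pow_right_of_lt_one₀ hg hlt (Finset.mem_range.1 hi)
  have h1 : 1 ≤ α / (1 - α) * ((n : ℝ) - 1) := by
    rw [div_mul_eq_mul_div, le_div_iff₀ (by linarith)]
    rw [div_le_iff₀ (by linarith)] at hα1
    linarith
  have hα0 : 0 < α := lt_of_lt_of_le (by positivity) hα1
  have h2 : 0 < α / (1 - α) := div_pos hα0 (by linarith)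
  have h3 := mul_lt_mul_of_pos_left hsum h2
  have h4 : 0 < g ^ (n - 1) := by positivity
  simp only [Rpoly] at hroot
  nlinarith

lemma mul_geom_sum_of_Rpoly_root {n : ℕ} (hn : 0 < n) {α g : ℝ} (hα : α < 1)
    (hroot : Rpoly n α g = 0) : α * ∑ i ∈ Finset.range n, g ^ i = g ^ (n - 1) := by
  obtain ⟨k, rfl⟩ := Nat.exists_eq_add_of_le' (Nat.one_le_iff_ne_zero.2 hn.ne')
  have h : 1 - α ≠ 0 := by linarith
  simp only [Rpoly, add_tsub_cancel_right] at hroot ⊢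
  rw [Finset.sum_range_succ]
  field_simp at hroot
  linarith

lemma exists_point {n : ℕ} (hn : 2 ≤ n) {α C g : ℝ} (hα1 : 1 / (n : ℝ) ≤ α) (hα2 : α < 1)
    (hg : 0 < g) (hroot : Rpoly n α g = 0) (hC : g ≤ C) :
    ∃ θ : Fin n → ℝ, LinearIndependent ℚ (Fin.cons (1 : ℝ) θ : Fin (n + 1) → ℝ) ∧
      lambdaUnif θ = ENNReal.ofReal α ∧ lambdaOrd θ = ENNReal.ofReal (C * α) := by
  have hn0 : 0 < n := by omega
  have hg1 := one_le_of_Rpoly_root hn hα1 hα2 hg hroot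
  have hgeom := mul_geom_sum_of_Rpoly_root hn0 hα2 hroot
  have hα0 : 0 < α := lt_of_lt_of_le (by positivity) hα1
  set D := C / g with hDdef
  have hD : 1 ≤ D := (one_le_div hg).2 hC
  have hCD : C = D * g := by rw [hDdef]; field_simp
  have hD0 : 0 < D := by linarith
  have hC0 : 0 < C := by linarith
  set M := profile n g D with hM
  set T := windowSum n M with hT
  have hgeomα : ∀ j, g ^ (j + 1) * (α * ∑ i ∈ Finset.range n, g ^ i) = g ^ (j + n) := by
    intro j
    rw [hgeom, ← pow_add]
    congr 1
    omega
  have hgeomC : ∀ j e, g ^ j * D ^ e * (C * α * ∑ i ∈ Finset.range n, g ^ i) =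
      g ^ (j + n) * D ^ (e + 1) := by
    intro j e
    rw [← hgeomα j, hCD]
    ring
  have hmono : StrictMono M := strictMono_nat_of_lt_succ fun k => by
    have := add_le_profile_succ (n := n) hg1 hD k
    linarith [(Nat.cast_nonneg k : (0 : ℝ) ≤ k)]
  have hsq : ∀ j : ℕ, (j : ℝ) ^ 2 ≤ M j := fun j =>
    le_trans (by nlinarith [(Nat.cast_nonneg j : (0 : ℝ) ≤ j)]) (sq_le_profile hg1 hD j)
  have hM0 : 0 ≤ M 0 := by simp [hM, profile_zero]
  have htop : Filter.Tendsto M Filter.atTop Filter.atTop :=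
    Filter.tendsto_atTop_mono hsq
      ((Filter.tendsto_pow_atTop two_ne_zero).comp tendsto_natCast_atTop_atTop)
  obtain ⟨θ, q, A, δ, hA, hδ, hind, hq0, hqs, hql, hqu, hψu, hψl⟩ :=
    exists_point_of_profile hn0 hM0 hmono htop (tendsto_exp_profile_gap hg1 hD)
  refine ⟨θ, hind, ?_⟩
  refine exponents_eq (N := fun j => M (j + n)) hA hδ hα0.le (by positivity) hq0 hqs hql hqu hψu
    hψl ?_ ?_ ?_ ?_ ?_
  · intro j
    refine (hsq j).trans ?_
    exact Finset.single_le_sum (f := fun i => M (j + i))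
      (fun i _ => hM0.trans (hmono.monotone (Nat.zero_le _))) (Finset.mem_range.2 hn0)
  · intro j
    have h := windowSum_profile_le (n := n) (j := j + 1) (e := (j + n) / n) (w := j + n) hg1 hD
      (fun i hi => Nat.div_le_div_right (by omega)) (by omega)
    refine (mul_le_mul_of_nonneg_left h hα0.le).trans (le_of_eq ?_)
    simp only [hM, profile]
    rw [← hgeomα j]
    ring
  · intro ε hε
    have hev := eventually_mul_sq_le n α hε
    rw [Filter.frequently_atTop]
    intro a
    obtain ⟨b, hb⟩ := Filter.eventually_atTop.1 hev
    set s := a + b + 1 with hs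
    have hns : s ≤ n * s := Nat.le_mul_of_pos_left s hn0
    obtain ⟨j, hj⟩ : ∃ j, j + 1 = n * s := ⟨n * s - 1, by omega⟩
    refine ⟨j, by omega, ?_⟩
    have hdiv : (j + n) / n = s := by
      rw [show j + n = n * s + (n - 1) by omega, Nat.mul_add_div hn0,
        Nat.div_eq_of_lt (by omega), add_zero]
    have h := le_windowSum_profile (n := n) (j := j + 1) (e := s) (w := j) hg1 hD
      (fun i hi => by rw [hj, Nat.mul_add_div hn0]; exact Nat.le_add_right _ _) (by omega)
    refine le_of_mul_le_mul_left (a := α) ?_ hα0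
    calc α * M (j + n) = α * (((j + n : ℕ) : ℝ) + 1) ^ 2 * (g ^ (j + n) * D ^ s) := by
          simp only [hM, profile, hdiv]
          ring
      _ ≤ (α + ε) * ((j : ℝ) + 1) ^ 2 * (g ^ (j + n) * D ^ s) := by
          exact mul_le_mul_of_nonneg_right (hb j (by omega)) (by positivity)
      _ = α * ((α + ε) * (((j : ℝ) + 1) ^ 2 * (g ^ (j + 1) * D ^ s) *
            ∑ i ∈ Finset.range n, g ^ i)) := by
          rw [← hgeomα j]
          ring
      _ ≤ _ := by gcongr
  · intro ε hε
    filter_upwards [eventually_mul_sq_le n (C * α) hε] with j hj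
    have h := le_windowSum_profile (n := n) (j := j) (e := j / n) (w := j) hg1 hD
      (fun i hi => Nat.div_le_div_right (by omega)) le_rfl
    refine le_of_mul_le_mul_left (a := C * α) ?_ (by positivity)
    calc C * α * M (j + n) = C * α * (((j + n : ℕ) : ℝ) + 1) ^ 2 *
            (g ^ (j + n) * D ^ (j / n + 1)) := by
          simp only [hM, profile, Nat.add_div_right j hn0]
          ring
      _ ≤ (C * α + ε) * ((j : ℝ) + 1) ^ 2 * (g ^ (j + n) * D ^ (j / n + 1)) := by
          exact mul_le_mul_of_nonneg_right hj (by positivity)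
      _ = C * α * ((C * α + ε) * (((j : ℝ) + 1) ^ 2 * (g ^ j * D ^ (j / n)) *
            ∑ i ∈ Finset.range n, g ^ i)) := by
          rw [← hgeomC j]
          ring
      _ ≤ _ := by gcongr
  · rw [Filter.frequently_atTop]
    intro a
    refine ⟨n * a, Nat.le_mul_of_pos_left a hn0, ?_⟩
    have h := windowSum_profile_le (n := n) (j := n * a) (e := a) (w := n * a + n) hg1 hD
      (fun i hi => by rw [Nat.mul_add_div hn0, Nat.div_eq_of_lt hi, add_zero]) (by omega)
    refine (mul_le_mul_of_nonneg_left h (by positivity)).trans (le_of_eq ?_)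
    have hdiv : (n * a + n) / n = a + 1 := by
      rw [Nat.add_div_right _ hn0, Nat.mul_div_cancel_left _ hn0]
    simp only [hM, profile, hdiv]
    rw [← hgeomC]
    ring

/-- For `n ≥ 2`, `1/n ≤ λ̂ < 1` and `C ≥ G(n, λ̂)` (the unique positive root `g`
of `R_{n,λ̂}`), the set of `θ` with `ℚ`-linearly independent coordinates with `1`,
`λ̂(θ) = λ̂` and `λ(θ) = C·λ̂` is infinite. -/
theorem statement3 {n : ℕ} (hn : 2 ≤ n) (lh : ℝ) (hlh1 : 1 / (n : ℝ) ≤ lh) (hlh2 : lh < 1)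
    (C g : ℝ) (hg : 0 < g) (hgroot : Rpoly n lh g = 0) (hC : g ≤ C) :
    {θ : Fin n → ℝ | LinearIndependent ℚ (Fin.cons (1 : ℝ) θ : Fin (n + 1) → ℝ) ∧
      lambdaUnif θ = ENNReal.ofReal lh ∧
      lambdaOrd θ = ENNReal.ofReal (C * lh)}.Infinite := by
  obtain ⟨θ, hind, hunif, hord⟩ := exists_point hn hlh1 hlh2 hg hgroot hC
  refine Set.infinite_of_injective_forall_mem (f := fun z : ℕ => fun i => θ i + ((z : ℤ) : ℝ))
    ?_ ?_
  · intro a b hab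
    simpa using congrFun hab ⟨0, by omega⟩
  · intro z
    refine ⟨linearIndependent_add_intCast hind z, ?_, ?_⟩
    · simpa only [lambdaUnif, psi_add_intCast] using hunif
    · simpa only [lambdaOrd, psi_add_intCast] using hord

end
end

section
/- Let n ≥ 3 be an integer and let α be a real number with 0 < α < 1. Then the unique positive root G(n,α) of R_{n,α} satisfies α/(1−α) < G(n,α) < 1/(1−α). -/
open scoped BigOperators

noncomputable section

/-- For `n ≥ 3` and `0 < α < 1`, the unique positive root `g = G(n,α)` of
`R_{n,α}` satisfies `α/(1-α) < g < 1/(1-α)`. -/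
theorem statement6 {n : ℕ} (hn : 3 ≤ n) (α : ℝ) (hα0 : 0 < α) (hα1 : α < 1)
    (g : ℝ) (hg : 0 < g) (hroot : Rpoly n α g = 0) :
    α / (1 - α) < g ∧ g < 1 / (1 - α) := by
  obtain ⟨m, rfl⟩ : ∃ m, n = m + 3 := ⟨n - 3, by omega⟩
  have hα : 0 < 1 - α := sub_pos.mpr hα1
  have hc : 0 < α / (1 - α) := div_pos hα0 hα
  have hc_succ : 1 / (1 - α) = α / (1 - α) + 1 := by
    field_simp
    ring
  rw [hc_succ]
  simp only [Rpoly, show m + 3 - 1 = m + 2 by omega] at hroot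
  generalize α / (1 - α) = c at hc hroot
  have hsum : ∀ k, 0 < ∑ i ∈ Finset.range (k + 1), g ^ i := fun k ↦
    Finset.sum_pos (fun i _ ↦ pow_pos hg i) ⟨0, by simp⟩
  constructor
  · rw [Finset.sum_range_succ] at hroot
    have hlt : c * g ^ (m + 1) < g * g ^ (m + 1) := by
      rw [← pow_succ']
      linarith [mul_pos hc (hsum m)]
    exact lt_of_mul_lt_mul_right hlt (pow_pos hg _).le
  · have hgeom := geom_sum_mul g (m + 2)
    refine lt_of_mul_lt_mul_right ?_ (hsum (m + 1)).le
    linarith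

end
end

section
/- Let n ≥ 1 and let θ ∈ ℝ^n be such that 1, θ_1, …, θ_n are linearly independent over ℚ, and let (z_l) be a sequence of best approximations to θ (for simultaneous approximation). Then for every index l, the two consecutive vectors z_l and z_{l+1} are linearly independent over ℝ, and the subgroup of ℤ^{n+1} they generate equals span_ℝ(z_l, z_{l+1}) ∩ ℤ^{n+1}. -/
open scoped BigOperators

noncomputable section

/-- The real vector attached to an integer vector. -/
def vecR {m : ℕ} (z : Fin m → ℤ) : Fin m → ℝ := fun i => (z i : ℝ)

/-- The approximation error `ξ = max_i |q θ_i - a_i|` of a vector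
`z = (q, a_1, …, a_n) ∈ ℤ^(n+1)`. -/
def xi {n : ℕ} (θ : Fin n → ℝ) (z : Fin (n + 1) → ℤ) : ℝ :=
  ⨆ i : Fin n, |(z 0 : ℝ) * θ i - (z i.succ : ℝ)|

/-- A sequence of best approximations to `θ` for simultaneous approximation:
`z l = (q_l, a_{1,l}, …, a_{n,l})`, `q_l > 0`, `(q_l)` strictly increasing,
`(ξ_l)` strictly decreasing, and any `q` with `0 < q < q_{l+1}` approximates
no better than `ξ_l`. -/
def IsBestApproxSeq {n : ℕ} (θ : Fin n → ℝ) (z : ℕ → Fin (n + 1) → ℤ) : Prop :=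
  (∀ l, 0 < z l 0) ∧
  (StrictMono fun l => z l 0) ∧
  (StrictAnti fun l => xi θ (z l)) ∧
  ∀ l : ℕ, ∀ q : ℤ, 0 < q → q < z (l + 1) 0 → ∀ a : Fin n → ℤ,
    xi θ (z l) ≤ ⨆ i : Fin n, |(q : ℝ) * θ i - (a i : ℝ)|

theorem abs_le_xi {n : ℕ} (θ : Fin n → ℝ) (w : Fin (n + 1) → ℤ) (i : Fin n) :
    |(w 0 : ℝ) * θ i - w i.succ| ≤ xi θ w :=
  le_ciSup (f := fun i : Fin n => |(w 0 : ℝ) * θ i - w i.succ|) (Set.finite_range _).bddAbove i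

theorem xi_nonneg {n : ℕ} (θ : Fin n → ℝ) (w : Fin (n + 1) → ℤ) : 0 ≤ xi θ w :=
  Real.iSup_nonneg fun _ => abs_nonneg _

theorem xi_neg {n : ℕ} (θ : Fin n → ℝ) (w : Fin (n + 1) → ℤ) : xi θ (-w) = xi θ w := by
  unfold xi
  congr 1
  ext i
  rw [← abs_neg]
  congr 1
  simp only [Pi.neg_apply]
  push_cast
  ring

/-- The approximation error is subadditive and homogeneous along real combinations. -/
theorem xi_le_of_combination {n : ℕ} [Nonempty (Fin n)] (θ : Fin n → ℝ)
    {u v w : Fin (n + 1) → ℤ} {a b : ℝ} (h : ∀ i, (w i : ℝ) = a * u i + b * v i) :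
    xi θ w ≤ |a| * xi θ u + |b| * xi θ v := by
  refine ciSup_le fun i => ?_
  have e : (w 0 : ℝ) * θ i - w i.succ =
      a * ((u 0 : ℝ) * θ i - u i.succ) + b * ((v 0 : ℝ) * θ i - v i.succ) := by
    rw [h, h]
    ring
  rw [e]
  refine (abs_add_le _ _).trans ?_
  rw [abs_mul, abs_mul]
  gcongr
  · exact abs_le_xi θ u i
  · exact abs_le_xi θ v i

theorem linearIndependent_vecR {n : ℕ} [Nonempty (Fin n)] (θ : Fin n → ℝ)
    {u v : Fin (n + 1) → ℤ} (hu : 0 < u 0) (huv : u 0 < v 0) (hξ : xi θ v < xi θ u) :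
    LinearIndependent ℝ ![vecR u, vecR v] := by
  have hu' : (0 : ℝ) < u 0 := by exact_mod_cast hu
  have huv' : (u 0 : ℝ) < v 0 := by exact_mod_cast huv
  rw [LinearIndependent.pair_iff]
  intro s t hst
  have h (i) : s * (u i : ℝ) + t * v i = 0 := by simpa [vecR] using congrFun hst i
  by_cases hs : s = 0
  · subst hs
    have := h 0
    simp only [zero_mul, zero_add, mul_eq_zero] at this
    exact ⟨rfl, this.resolve_right (hu'.trans huv').ne'⟩
  · exfalso
    have hle := xi_le_of_combination θ (u := v) (v := 0) (w := u) (a := -t / s) (b := 0)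
      (fun i => by
        have := h i
        field_simp
        simp
        linarith)
    have hc : |-t / s| ≤ 1 := by
      have e : -t / s = u 0 / v 0 := by
        have := h 0
        have := (hu'.trans huv').ne'
        field_simp
        linarith
      rw [e, abs_of_pos (by have := hu'.trans huv'; positivity),
        div_le_one (hu'.trans huv')]
      exact huv'.le
    simp only [abs_zero, zero_mul, add_zero] at hle
    have := mul_le_of_le_one_left (xi_nonneg θ v) hc
    linarith

namespace IsBestApproxSeq

variable {n : ℕ} {θ : Fin n → ℝ} {z : ℕ → Fin (n + 1) → ℤ}

theorem pos (hz : IsBestApproxSeq θ z) (l : ℕ) : 0 < z l 0 := hz.1 l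

theorem lt (hz : IsBestApproxSeq θ z) (l : ℕ) : z l 0 < z (l + 1) 0 :=
  hz.2.1 (Nat.lt_succ_self l)

theorem xi_le (hz : IsBestApproxSeq θ z) (l : ℕ) {w : Fin (n + 1) → ℤ} (hw : w 0 ≠ 0)
    (hlt : |w 0| < z (l + 1) 0) : xi θ (z l) ≤ xi θ w := by
  rcases lt_or_gt_of_ne hw with h | h
  · rw [← xi_neg θ w]
    exact hz.2.2.2 l ((-w) 0) (by simpa using h) (by simpa [abs_of_neg h] using hlt)
      fun i => (-w) i.succ
  · exact hz.2.2.2 l (w 0) h (by simpa [abs_of_pos h] using hlt) fun i => w i.succ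

theorem xi_le_half [Nonempty (Fin n)] (hz : IsBestApproxSeq θ z) (l : ℕ) :
    xi θ (z l) ≤ 1 / 2 := by
  have h1 := hz.pos l
  have h2 := hz.lt l
  refine (hz.2.2.2 l 1 one_pos (by omega) fun i => round (θ i)).trans (ciSup_le fun i => ?_)
  simpa using abs_sub_round (θ i)

/-- An integer point in the half-size parallelogram spanned by two consecutive best
approximation vectors is zero. -/
theorem eq_zero_of_combination [Nonempty (Fin n)] (hz : IsBestApproxSeq θ z) (l : ℕ)
    {w : Fin (n + 1) → ℤ} {a b : ℝ} (ha : |a| ≤ 1 / 2) (hb : |b| ≤ 1 / 2)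
    (h : ∀ i, (w i : ℝ) = a * z l i + b * z (l + 1) i) : w = 0 := by
  have hu : (0 : ℝ) < z l 0 := by exact_mod_cast hz.pos l
  have hq : (z l 0 : ℝ) < z (l + 1) 0 := by exact_mod_cast hz.lt l
  have hξ : xi θ (z (l + 1)) < xi θ (z l) := hz.2.2.1 (Nat.lt_succ_self l)
  have hlt : xi θ w < xi θ (z l) := by
    have h1 := xi_le_of_combination θ h
    have h2 := mul_le_mul_of_nonneg_right ha (xi_nonneg θ (z l))
    have h3 := mul_le_mul_of_nonneg_right hb (xi_nonneg θ (z (l + 1)))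
    linarith
  have hw0 : w 0 = 0 := by
    by_contra hne
    refine hlt.not_ge (hz.xi_le l hne ?_)
    have h1 : |(w 0 : ℝ)| ≤ |a| * z l 0 + |b| * z (l + 1) 0 := by
      rw [h 0]
      refine (abs_add_le _ _).trans ?_
      rw [abs_mul, abs_mul, abs_of_pos hu, abs_of_pos (hu.trans hq)]
    have h2 := mul_le_mul_of_nonneg_right ha hu.le
    have h3 := mul_le_mul_of_nonneg_right hb (hu.trans hq).le
    have h4 : |(w 0 : ℝ)| < z (l + 1) 0 := by linarith
    exact_mod_cast h4
  ext i
  refine Fin.cases hw0 (fun j => ?_) i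
  have h1 := abs_le_xi θ w j
  rw [hw0] at h1
  simp only [Int.cast_zero, zero_mul, zero_sub, abs_neg] at h1
  have h2 : |(w j.succ : ℝ)| < 1 := by linarith [hz.xi_le_half l]
  exact Int.abs_lt_one_iff.mp (by exact_mod_cast h2)

end IsBestApproxSeq

/-- Two consecutive best approximation vectors are linearly independent over
`ℝ`, and the subgroup of `ℤ^(n+1)` they generate is exactly the set of integer
points of their real span. -/
theorem statement8 {n : ℕ} (hn : 1 ≤ n) (θ : Fin n → ℝ)
    (hθ : LinearIndependent ℚ (Fin.cons (1 : ℝ) θ : Fin (n + 1) → ℝ))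
    (z : ℕ → Fin (n + 1) → ℤ) (hz : IsBestApproxSeq θ z) (l : ℕ) :
    LinearIndependent ℝ ![vecR (z l), vecR (z (l + 1))] ∧
    ((AddSubgroup.closure ({vecR (z l), vecR (z (l + 1))} : Set (Fin (n + 1) → ℝ)) :
        AddSubgroup (Fin (n + 1) → ℝ)) : Set (Fin (n + 1) → ℝ)) =
      {x : Fin (n + 1) → ℝ |
        x ∈ Submodule.span ℝ ({vecR (z l), vecR (z (l + 1))} : Set (Fin (n + 1) → ℝ)) ∧
        ∀ i, ∃ k : ℤ, x i = (k : ℝ)} := by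
  have hu := hz.pos l
  have hq := hz.lt l
  have hξ : xi θ (z (l + 1)) < xi θ (z l) := hz.2.2.1 (Nat.lt_succ_self l)
  have : Nonempty (Fin n) := ⟨⟨0, hn⟩⟩
  refine ⟨linearIndependent_vecR θ hu hq hξ, ?_⟩
  ext x
  constructor
  · intro hx
    obtain ⟨m, k, rfl⟩ := AddSubgroup.mem_closure_pair.mp hx
    refine ⟨?_, fun i => ⟨m * z l i + k * z (l + 1) i, ?_⟩⟩
    · exact add_mem (zsmul_mem (Submodule.subset_span (by simp)) m)
        (zsmul_mem (Submodule.subset_span (by simp)) k)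
    · simp [vecR]
  · rintro ⟨hx, hint⟩
    obtain ⟨a, b, rfl⟩ := Submodule.mem_span_pair.mp hx
    choose y hy using hint
    refine AddSubgroup.mem_closure_pair.mpr ⟨round a, round b, ?_⟩
    have hw := hz.eq_zero_of_combination l
      (w := fun i => y i - round a * z l i - round b * z (l + 1) i)
      (abs_sub_round a) (abs_sub_round b) (fun i => by
        have := hy i
        simp only [vecR, Pi.add_apply, Pi.smul_apply, smul_eq_mul] at this
        push_cast
        rw [← this]
        ring)
    ext i
    rw [hy i]
    have hi : y i - round a * z l i - round b * z (l + 1) i = 0 := congrFun hw i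
    have hi' : y i = round a * z l i + round b * z (l + 1) i := by linarith
    simp [vecR, hi']

end
end

section
/- Let d ≥ 1 and let Λ ⊂ ℝ^d be a lattice of full rank d (a discrete subgroup spanning ℝ^d). Call a linear subspace M ⊆ ℝ^d Λ-rational if M ∩ Λ spans M over ℝ; for a Λ-rational subspace M let H_Λ(M) denote the covolume of the lattice M ∩ Λ inside M (with H_Λ({0}) = 1). Then for any two Λ-rational subspaces A and B of ℝ^d, both A + B and A ∩ B are Λ-rational and H_Λ(A + B) · H_Λ(A ∩ B) ≤ H_Λ(A) · H_Λ(B). -/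
open scoped BigOperators

noncomputable section

/-- Gram matrix of a family of vectors in `ℝ^m` (standard inner product). -/
def gram {r m : ℕ} (v : Fin r → Fin m → ℝ) : Matrix (Fin r) (Fin r) ℝ :=
  Matrix.of (fun i j => ∑ k, v i k * v j k)

/-- Covolume (volume of a fundamental parallelepiped) of the lattice generated
by a linearly independent family of vectors of `ℝ^m`. -/
def covol {r m : ℕ} (v : Fin r → Fin m → ℝ) : ℝ := Real.sqrt (gram v).det

/-- The subgroup of integer points of `ℝ^m`. -/
def intPoints (m : ℕ) : AddSubgroup (Fin m → ℝ) where
  carrier := {v | ∀ i, ∃ k : ℤ, v i = (k : ℝ)}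
  zero_mem' := fun i => ⟨0, by simp⟩
  add_mem' := by
    intro a b ha hb i
    obtain ⟨p, hp⟩ := ha i
    obtain ⟨q, hq⟩ := hb i
    exact ⟨p + q, by simp [hp, hq]⟩
  neg_mem' := by
    intro a ha i
    obtain ⟨p, hp⟩ := ha i
    exact ⟨-p, by simp [hp]⟩

open scoped Classical in
/-- Covolume (fundamental volume) of a subgroup of `ℝ^m` generated by some
linearly independent family of vectors; junk value `0` otherwise. -/
def latticeDet {m : ℕ} (Γ : AddSubgroup (Fin m → ℝ)) : ℝ :=
  if h : ∃ r : ℕ, ∃ v : Fin r → Fin m → ℝ, LinearIndependent ℝ v ∧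
      AddSubgroup.closure (Set.range v) = Γ
  then covol h.choose_spec.choose
  else 0

namespace Matrix

open scoped MatrixOrder

variable {m n p : Type*}

lemma PosDef.toBlocks₁₁ {G : Matrix (m ⊕ n) (m ⊕ n) ℝ} (hG : G.PosDef) : G.toBlocks₁₁.PosDef :=
  hG.submatrix Sum.inl_injective

lemma IsHermitian.toBlocks₂₁_eq {G : Matrix (m ⊕ n) (m ⊕ n) ℝ} (hG : G.IsHermitian) :
    G.toBlocks₂₁ = G.toBlocks₁₂ᴴ := by
  ext i j
  exact (hG.apply _ _).symm

variable [Fintype m] [DecidableEq m] [Fintype n] [DecidableEq n] [Fintype p] [DecidableEq p]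

lemma PosSemidef.one_le_det_one_add {Z : Matrix n n ℝ} (hZ : Z.PosSemidef) :
    1 ≤ (1 + Z).det := by
  have hH : (1 + Z).IsHermitian := isHermitian_one.add hZ.1
  rw [hH.det_eq_prod_eigenvalues]
  refine Finset.prod_induction _ (1 ≤ ·) (fun _ _ => one_le_mul_of_one_le_of_one_le) le_rfl
    fun i _ => ?_
  have hv : star (hH.eigenvectorBasis i).ofLp ⬝ᵥ (hH.eigenvectorBasis i).ofLp = 1 := by
    have h := hH.eigenvectorBasis.orthonormal.1 i
    have h' : inner ℝ (hH.eigenvectorBasis i) (hH.eigenvectorBasis i) = 1 := by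
      rw [real_inner_self_eq_norm_sq, h, one_pow]
    rw [← h', EuclideanSpace.inner_eq_star_dotProduct, dotProduct_comm]
  have hz := hZ.dotProduct_mulVec_nonneg (hH.eigenvectorBasis i).ofLp
  simp only [RCLike.ofReal_real_eq_id, id]
  rw [hH.eigenvalues_eq, add_mulVec, dotProduct_add, one_mulVec, hv]
  simpa using hz

lemma PosDef.det_le_det_add {X Z : Matrix n n ℝ} (hX : X.PosDef) (hZ : Z.PosSemidef) :
    X.det ≤ (X + Z).det := by
  obtain ⟨B, rfl⟩ := CStarAlgebra.nonneg_iff_eq_star_mul_self.mp hX.posSemidef.nonneg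
  rw [star_eq_conjTranspose] at *
  have hB : IsUnit B.det := by
    have h := hX.det_pos.ne'
    rw [det_mul] at h
    exact isUnit_iff_ne_zero.2 (right_ne_zero_of_mul h)
  have key : Bᴴ * B + Z = Bᴴ * (1 + B⁻¹ᴴ * Z * B⁻¹) * B := by
    have h1 : Bᴴ * B⁻¹ᴴ = 1 := by
      rw [← conjTranspose_mul, nonsing_inv_mul _ hB, conjTranspose_one]
    have h2 : B⁻¹ * B = 1 := nonsing_inv_mul _ hB
    calc Bᴴ * B + Z = Bᴴ * B + (Bᴴ * B⁻¹ᴴ) * Z * (B⁻¹ * B) := by rw [h1, h2, one_mul, mul_one]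
      _ = _ := by simp only [mul_add, add_mul, mul_one, Matrix.mul_assoc]
  have h1 := (hZ.conjTranspose_mul_mul_same B⁻¹).one_le_det_one_add
  have h0 := hX.posSemidef.det_nonneg
  rw [key, det_mul (_ * _) B, det_mul Bᴴ (1 + _), mul_right_comm, ← det_mul Bᴴ B]
  exact le_mul_of_one_le_right h0 h1

/-- The Schur complement of the upper left block. -/
def schurCompl (G : Matrix (m ⊕ n) (m ⊕ n) ℝ) : Matrix n n ℝ :=
  G.toBlocks₂₂ - G.toBlocks₂₁ * G.toBlocks₁₁⁻¹ * G.toBlocks₁₂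

lemma PosDef.det_eq_mul_det_schurCompl {G : Matrix (m ⊕ n) (m ⊕ n) ℝ} (hG : G.PosDef) :
    G.det = G.toBlocks₁₁.det * G.schurCompl.det := by
  have := hG.toBlocks₁₁.isUnit.invertible
  conv_lhs => rw [← fromBlocks_toBlocks G, det_fromBlocks₁₁]
  rw [schurCompl, invOf_eq_nonsing_inv]

lemma PosDef.schurCompl {G : Matrix (m ⊕ n) (m ⊕ n) ℝ} (hG : G.PosDef) :
    G.schurCompl.PosDef := by
  have hS : G.schurCompl.PosSemidef := by
    have := hG.toBlocks₁₁.isUnit.invertible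
    rw [Matrix.schurCompl, hG.1.toBlocks₂₁_eq, ← PosDef.fromBlocks₁₁ _ _ hG.toBlocks₁₁,
      ← hG.1.toBlocks₂₁_eq, fromBlocks_toBlocks]
    exact hG.posSemidef
  refine hS.posDef_iff_det_ne_zero.2 fun h => hG.det_pos.ne' ?_
  rw [hG.det_eq_mul_det_schurCompl, h, mul_zero]

/-- Fischer's inequality. -/
lemma PosDef.det_le_det_toBlocks_mul {G : Matrix (m ⊕ n) (m ⊕ n) ℝ} (hG : G.PosDef) :
    G.det ≤ G.toBlocks₁₁.det * G.toBlocks₂₂.det := by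
  rw [hG.det_eq_mul_det_schurCompl]
  refine mul_le_mul_of_nonneg_left ?_ hG.toBlocks₁₁.det_pos.le
  have hZ : (G.toBlocks₂₁ * G.toBlocks₁₁⁻¹ * G.toBlocks₁₂).PosSemidef := by
    rw [hG.1.toBlocks₂₁_eq]
    exact hG.toBlocks₁₁.inv.posSemidef.conjTranspose_mul_mul_same _
  simpa [Matrix.schurCompl] using hG.schurCompl.det_le_det_add hZ

/-- Koteljanskii's inequality. -/
lemma PosDef.det_mul_det_toBlocks₁₁_le {G : Matrix (m ⊕ (n ⊕ p)) (m ⊕ (n ⊕ p)) ℝ}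
    (hG : G.PosDef) :
    G.det * G.toBlocks₁₁.det ≤
      (G.submatrix (Sum.map id Sum.inl) (Sum.map id Sum.inl)).det *
        (G.submatrix (Sum.map id Sum.inr) (Sum.map id Sum.inr)).det := by
  have h₁ : (G.submatrix (Sum.map id (Sum.inl : n → n ⊕ p)) (Sum.map id Sum.inl)).PosDef :=
    hG.submatrix (Function.injective_id.sumMap Sum.inl_injective)
  have h₂ : (G.submatrix (Sum.map id (Sum.inr : p → n ⊕ p)) (Sum.map id Sum.inr)).PosDef :=
    hG.submatrix (Function.injective_id.sumMap Sum.inr_injective)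
  have e₁ : (G.submatrix (Sum.map id (Sum.inl : n → n ⊕ p)) (Sum.map id Sum.inl)).det =
      G.toBlocks₁₁.det * G.schurCompl.toBlocks₁₁.det := h₁.det_eq_mul_det_schurCompl
  have e₂ : (G.submatrix (Sum.map id (Sum.inr : p → n ⊕ p)) (Sum.map id Sum.inr)).det =
      G.toBlocks₁₁.det * G.schurCompl.toBlocks₂₂.det := h₂.det_eq_mul_det_schurCompl
  rw [e₁, e₂, hG.det_eq_mul_det_schurCompl]
  calc _ = G.toBlocks₁₁.det ^ 2 * G.schurCompl.det := by ring
    _ ≤ G.toBlocks₁₁.det ^ 2 * (G.schurCompl.toBlocks₁₁.det * G.schurCompl.toBlocks₂₂.det) :=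
      mul_le_mul_of_nonneg_left hG.schurCompl.det_le_det_toBlocks_mul (sq_nonneg _)
    _ = _ := by ring

end Matrix

/-- The Gram determinant of a finite family of vectors of `ℝ^d`. -/
def gramDet {d : ℕ} {ι : Type*} [Fintype ι] [DecidableEq ι] (v : ι → Fin d → ℝ) : ℝ :=
  (Matrix.of v * (Matrix.of v).transpose).det

lemma covol_eq_sqrt_gramDet {r d : ℕ} (v : Fin r → Fin d → ℝ) : covol v = √(gramDet v) := rfl

section GramDet

variable {d : ℕ} {ι κ μ : Type*} [Fintype ι] [Fintype κ] [Fintype μ]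

lemma LinearIndependent.posDef_mul_transpose {v : ι → Fin d → ℝ} (hv : LinearIndependent ℝ v) :
    (Matrix.of v * (Matrix.of v).transpose).PosDef := by
  rw [← Matrix.conjTranspose_eq_transpose_of_trivial]
  exact Matrix.PosDef.mul_conjTranspose_self _ (Matrix.vecMul_injective_iff.2 hv)

variable [DecidableEq ι] [DecidableEq κ] [DecidableEq μ]

lemma gramDet_comp_equiv (v : κ → Fin d → ℝ) (e : ι ≃ κ) : gramDet (v ∘ e) = gramDet v :=
  Matrix.det_submatrix_equiv_self e (Matrix.of v * (Matrix.of v).transpose)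

lemma gramDet_le_of_span_le {v : ι → Fin d → ℝ} {w : κ → Fin d → ℝ} (hv : LinearIndependent ℝ v)
    (hcard : Fintype.card ι = Fintype.card κ)
    (hle : Submodule.span ℤ (Set.range v) ≤ Submodule.span ℤ (Set.range w)) :
    gramDet w ≤ gramDet v := by
  obtain ⟨e⟩ := Fintype.card_eq.1 hcard
  have hmem (i : ι) : ∃ c : ι → ℤ, ∑ j, c j • w (e j) = v i := by
    have h := hle (Submodule.subset_span (Set.mem_range_self i))
    rw [← e.surjective.range_comp] at h
    exact (Submodule.mem_span_range_iff_exists_fun ℤ).1 h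
  choose M hM using hmem
  let N : Matrix ι ι ℝ := (Matrix.of M).map (Int.castRingHom ℝ)
  have hV : Matrix.of v = N * Matrix.of (w ∘ e) := by
    ext i k
    simp [← hM i, N, Matrix.mul_apply]
  have hdet : gramDet v = N.det ^ 2 * gramDet w := by
    rw [← gramDet_comp_equiv w e, gramDet, gramDet, hV, Matrix.transpose_mul, Matrix.mul_assoc,
      ← Matrix.mul_assoc (Matrix.of (w ∘ e)), Matrix.det_mul, Matrix.det_mul,
      Matrix.det_transpose]
    ring
  have hN : N.det = ((Matrix.of M).det : ℤ) := ((Int.castRingHom ℝ).map_det _).symm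
  have hpos : 0 < gramDet v := hv.posDef_mul_transpose.det_pos
  have hne : (Matrix.of M).det ≠ 0 := fun h => by simp [hdet, hN, h] at hpos
  have hone : (1 : ℝ) ≤ N.det ^ 2 := by
    rw [hN]
    exact_mod_cast Int.add_one_le_of_lt (sq_pos_of_ne_zero hne)
  rw [hdet] at hpos ⊢
  exact le_mul_of_one_le_left (pos_of_mul_pos_right hpos (sq_nonneg _)).le hone

lemma gramDet_mul_gramDet_le {c : ι → Fin d → ℝ} {a : κ → Fin d → ℝ} {b : μ → Fin d → ℝ}
    (h : LinearIndependent ℝ (Sum.elim c (Sum.elim a b))) :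
    gramDet (Sum.elim c (Sum.elim a b)) * gramDet c ≤
      gramDet (Sum.elim c a) * gramDet (Sum.elim c b) := by
  have e₁ : Sum.elim c (Sum.elim a b) ∘ Sum.map id Sum.inl = Sum.elim c a := by
    ext (i | i) <;> rfl
  have e₂ : Sum.elim c (Sum.elim a b) ∘ Sum.map id Sum.inr = Sum.elim c b := by
    ext (i | i) <;> rfl
  rw [← e₁, ← e₂]
  exact h.posDef_mul_transpose.det_mul_det_toBlocks₁₁_le

end GramDet

section Lattice

variable {d : ℕ}

open Submodule Module

lemma LinearIndependent.real_of_int {ι : Type*} [Fintype ι] {v : ι → Fin d → ℝ}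
    (hv : LinearIndependent ℤ v) (hd : DiscreteTopology (span ℤ (Set.range v))) :
    LinearIndependent ℝ v := by
  rw [linearIndependent_iff_card_eq_finrank_span] at hv ⊢
  rw [hv, Real.finrank_eq_int_finrank_of_discrete hd]

lemma discreteTopology_of_le {L L' : Submodule ℤ (Fin d → ℝ)} (h : L ≤ L')
    [DiscreteTopology L'] : DiscreteTopology L :=
  DiscreteTopology.of_subset (s := (L' : Set (Fin d → ℝ))) inferInstance h

lemma exists_linearIndependent_span_eq (L : Submodule ℤ (Fin d → ℝ)) [DiscreteTopology L] :
    ∃ (n : ℕ) (v : Fin n → Fin d → ℝ), LinearIndependent ℝ v ∧ span ℤ (Set.range v) = L := by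
  have b := finBasis ℤ L
  have hs : span ℤ (Set.range (L.subtype ∘ b)) = L := by
    rw [Set.range_comp, ← map_span, b.span_eq, Submodule.map_top, range_subtype]
  have hi : LinearIndependent ℤ (L.subtype ∘ b) :=
    b.linearIndependent.map' _ L.ker_subtype
  exact ⟨_, _, hi.real_of_int (by rwa [hs]), hs⟩

lemma isAddTorsionFree_of_module_real (V : Type*) [AddCommGroup V] [Module ℝ V] :
    IsAddTorsionFree V :=
  have : Module ℚ V := Module.compHom V (algebraMap ℚ ℝ)
  .of_module_rat V

/-- A `ℤ`-basis of the lattice points in a subspace `C` extends to a `ℤ`-basis of the lattice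
points in any larger subspace `A`. -/
lemma exists_extension_span_eq {L : Submodule ℤ (Fin d → ℝ)} [DiscreteTopology L]
    {C A : Submodule ℝ (Fin d → ℝ)} (hCA : C ≤ A) {ι : Type*} [Fintype ι] {c : ι → Fin d → ℝ}
    (hc : LinearIndependent ℝ c)
    (hcs : span ℤ (Set.range c) = C.restrictScalars ℤ ⊓ L) :
    ∃ (n : ℕ) (a : Fin n → Fin d → ℝ), LinearIndependent ℝ (Sum.elim c a) ∧
      span ℤ (Set.range (Sum.elim c a)) = A.restrictScalars ℤ ⊓ L := by
  let g : (Fin d → ℝ) →ₗ[ℤ] (Fin d → ℝ) ⧸ C := C.mkQ.restrictScalars ℤ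
  have hg (x : Fin d → ℝ) : g x = 0 ↔ x ∈ C := Quotient.mk_eq_zero C
  let LA := A.restrictScalars ℤ ⊓ L
  have : DiscreteTopology LA := discreteTopology_of_le inf_le_right
  have := isAddTorsionFree_of_module_real ((Fin d → ℝ) ⧸ C)
  have q := finBasis ℤ (LA.map g)
  have hq (i) : ∃ x ∈ LA, g x = q i := (q i).2
  choose a haL hga using hq
  have hga' : g ∘ a = (LA.map g).subtype ∘ q := funext hga
  have hi : LinearIndependent ℤ (g ∘ a) := by
    rw [hga']
    exact q.linearIndependent.map' _ (ker_subtype _)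
  have hgs : span ℤ (Set.range (g ∘ a)) = LA.map g := by
    rw [hga', Set.range_comp, ← map_span, q.span_eq, Submodule.map_top, range_subtype]
  have hcker : span ℤ (Set.range c) ≤ LinearMap.ker g := by
    rw [hcs]
    exact fun x hx => (hg x).2 hx.1
  have hdisj : Disjoint (span ℤ (Set.range c)) (span ℤ (Set.range a)) :=
    ((range_ker_disjoint hi).mono_right hcker).symm
  have hcZ : LinearIndependent ℤ c := hc.restrict_scalars (by
    intro x y h
    simpa using h)
  have hspan : span ℤ (Set.range (Sum.elim c a)) = LA := by
    rw [Set.Sum.elim_range, span_union]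
    refine le_antisymm (sup_le ?_ ?_) fun x hx => ?_
    · rw [hcs]
      exact inf_le_inf_right _ hCA
    · rw [span_le]
      rintro _ ⟨i, rfl⟩
      exact haL i
    · have hx' : g x ∈ (span ℤ (Set.range a)).map g := by
        rw [map_span, ← Set.range_comp, hgs]
        exact mem_map_of_mem hx
      obtain ⟨y, hy, hyx⟩ := hx'
      have hyL : y ∈ LA := (span_le.2 (by rintro _ ⟨i, rfl⟩; exact haL i) :
        span ℤ (Set.range a) ≤ LA) hy
      have hxy : x - y ∈ span ℤ (Set.range c) := by
        rw [hcs]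
        exact ⟨(hg _).1 (by rw [map_sub, hyx, sub_self]), (LA.sub_mem hx hyL).2⟩
      rw [← sub_add_cancel x y]
      exact add_mem (mem_sup_left hxy) (mem_sup_right hy)
  exact ⟨_, a, (hcZ.sum_type (hi.of_comp g) hdisj).real_of_int (by rwa [hspan]), hspan⟩

lemma latticeDet_eq_sqrt_gramDet {Γ : AddSubgroup (Fin d → ℝ)} {ι : Type*} [Fintype ι]
    [DecidableEq ι] {v : ι → Fin d → ℝ} (hv : LinearIndependent ℝ v)
    (hs : AddSubgroup.closure (Set.range v) = Γ) : latticeDet Γ = √(gramDet v) := by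
  have hex : ∃ r : ℕ, ∃ v : Fin r → Fin d → ℝ, LinearIndependent ℝ v ∧
      AddSubgroup.closure (Set.range v) = Γ := by
    let e := Fintype.equivFin ι
    exact ⟨_, v ∘ e.symm, hv.comp _ e.symm.injective, by rw [e.symm.surjective.range_comp, hs]⟩
  rw [latticeDet, dif_pos hex, covol_eq_sqrt_gramDet]
  obtain ⟨hw, hws⟩ := hex.choose_spec.choose_spec
  set w := hex.choose_spec.choose
  have hspan : span ℤ (Set.range v) = span ℤ (Set.range w) :=
    Submodule.toAddSubgroup_injective (by simp only [span_int_eq_addSubgroupClosure, hs, hws])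
  have hspan' : span ℝ (Set.range v) = span ℝ (Set.range w) := by
    rw [← span_span_of_tower ℤ ℝ (Set.range v), hspan, span_span_of_tower]
  have hcard : Fintype.card ι = Fintype.card (Fin hex.choose) := by
    rw [← finrank_span_eq_card hv, ← finrank_span_eq_card hw, hspan']
  rw [le_antisymm (gramDet_le_of_span_le hw hcard.symm hspan.ge)
    (gramDet_le_of_span_le hv hcard hspan.le)]

end Lattice

lemma linearIndependent_sumElim_sumElim_int {V ι κ μ : Type*} [AddCommGroup V]
    {c : ι → V} {a : κ → V} {b : μ → V}
    (ha : LinearIndependent ℤ (Sum.elim c a)) (hb : LinearIndependent ℤ (Sum.elim c b))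
    (hinf : Submodule.span ℤ (Set.range (Sum.elim c a)) ⊓
      Submodule.span ℤ (Set.range (Sum.elim c b)) ≤ Submodule.span ℤ (Set.range c)) :
    LinearIndependent ℤ (Sum.elim c (Sum.elim a b)) := by
  obtain ⟨-, hb', hdisj⟩ := linearIndependent_sum.1 hb
  have hd : Disjoint (Submodule.span ℤ (Set.range (Sum.elim c a)))
      (Submodule.span ℤ (Set.range b)) := by
    rw [Submodule.disjoint_def]
    intro x hxa hxb
    have hxc := hinf ⟨hxa, by
      rw [Set.Sum.elim_range, Submodule.span_union]
      exact Submodule.mem_sup_right hxb⟩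
    exact Submodule.disjoint_def.1 hdisj x hxc hxb
  have h := (ha.sum_type hb' hd).comp _ (Equiv.sumAssoc ι κ μ).symm.injective
  have heq : Sum.elim c (Sum.elim a b) =
      Sum.elim (Sum.elim c a) (Sum.elim c b ∘ Sum.inr) ∘ (Equiv.sumAssoc ι κ μ).symm := by
    ext (i | i | i) <;> rfl
  rwa [heq]

/-- Schmidt's inequality on heights, for an arbitrary full-rank lattice
`Λ ⊂ ℝ^d`: if `A`, `B` are `Λ`-rational subspaces then so are `A + B` and
`A ∩ B`, and `H_Λ(A + B) · H_Λ(A ∩ B) ≤ H_Λ(A) · H_Λ(B)`. -/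
theorem statement11 {d : ℕ} (hd : 1 ≤ d) (Λ : AddSubgroup (Fin d → ℝ))
    (hdisc : ∃ ε : ℝ, 0 < ε ∧ ∀ x ∈ Λ, x ≠ 0 → ε ≤ ‖x‖)
    (hfull : Submodule.span ℝ (Λ : Set (Fin d → ℝ)) = ⊤)
    (A B : Submodule ℝ (Fin d → ℝ))
    (hA : Submodule.span ℝ ((A : Set (Fin d → ℝ)) ∩ (Λ : Set (Fin d → ℝ))) = A)
    (hB : Submodule.span ℝ ((B : Set (Fin d → ℝ)) ∩ (Λ : Set (Fin d → ℝ))) = B) :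
    Submodule.span ℝ
        (((A ⊔ B : Submodule ℝ (Fin d → ℝ)) : Set (Fin d → ℝ)) ∩ (Λ : Set (Fin d → ℝ))) =
      A ⊔ B ∧
    Submodule.span ℝ
        (((A ⊓ B : Submodule ℝ (Fin d → ℝ)) : Set (Fin d → ℝ)) ∩ (Λ : Set (Fin d → ℝ))) =
      A ⊓ B ∧
    latticeDet ((A ⊔ B).toAddSubgroup ⊓ Λ) * latticeDet ((A ⊓ B).toAddSubgroup ⊓ Λ) ≤
      latticeDet (A.toAddSubgroup ⊓ Λ) * latticeDet (B.toAddSubgroup ⊓ Λ) := by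
  let L : Submodule ℤ (Fin d → ℝ) := AddSubgroup.toIntSubmodule Λ
  have : DiscreteTopology L := by
    obtain ⟨ε, hε, h⟩ := hdisc
    exact .of_forall_le_norm hε fun x hx => h x x.2 fun h0 => hx (Subtype.ext h0)
  have hrat {M : Submodule ℝ (Fin d → ℝ)} {ι : Type} {v : ι → Fin d → ℝ}
      (hv : Submodule.span ℤ (Set.range v) = M.restrictScalars ℤ ⊓ L) :
      Submodule.span ℝ ((M : Set (Fin d → ℝ)) ∩ (Λ : Set (Fin d → ℝ))) =
        Submodule.span ℝ (Set.range v) := by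
    rw [← Submodule.span_span_of_tower ℤ ℝ (Set.range v), hv]
    rfl
  have hlat {M : Submodule ℝ (Fin d → ℝ)} {ι : Type} [Fintype ι] [DecidableEq ι]
      {v : ι → Fin d → ℝ} (hi : LinearIndependent ℝ v)
      (hv : Submodule.span ℤ (Set.range v) = M.restrictScalars ℤ ⊓ L) :
      latticeDet (M.toAddSubgroup ⊓ Λ) = √(gramDet v) := by
    refine latticeDet_eq_sqrt_gramDet hi ?_
    rw [← Submodule.span_int_eq_addSubgroupClosure, hv]
    rfl
  have hdiscM (M : Submodule ℝ (Fin d → ℝ)) :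
      DiscreteTopology (M.restrictScalars ℤ ⊓ L : Submodule ℤ (Fin d → ℝ)) :=
    discreteTopology_of_le inf_le_right
  obtain ⟨_, c, hci, hc⟩ :=
    exists_linearIndependent_span_eq ((A ⊓ B).restrictScalars ℤ ⊓ L)
  obtain ⟨_, a, hai, ha⟩ := exists_extension_span_eq inf_le_left hci hc
  obtain ⟨_, b, hbi, hb⟩ := exists_extension_span_eq inf_le_right hci hc
  obtain ⟨_, w, hwi, hw⟩ :=
    exists_linearIndependent_span_eq ((A ⊔ B).restrictScalars ℤ ⊓ L)
  have hsup : Submodule.span ℝ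
      (((A ⊔ B : Submodule ℝ (Fin d → ℝ)) : Set (Fin d → ℝ)) ∩ (Λ : Set (Fin d → ℝ))) =
      A ⊔ B := by
    refine le_antisymm (Submodule.span_le.2 Set.inter_subset_left) (sup_le ?_ ?_)
    · conv_lhs => rw [← hA]
      exact Submodule.span_mono
        (Set.inter_subset_inter_left _ (le_sup_left : A ≤ A ⊔ B))
    · conv_lhs => rw [← hB]
      exact Submodule.span_mono
        (Set.inter_subset_inter_left _ (le_sup_right : B ≤ A ⊔ B))
  have hv : Submodule.span ℤ (Set.range (Sum.elim c (Sum.elim a b))) =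
      (A.restrictScalars ℤ ⊓ L) ⊔ (B.restrictScalars ℤ ⊓ L) := by
    rw [← ha, ← hb]
    simp only [Set.Sum.elim_range, Submodule.span_union]
    rw [sup_sup_sup_comm, sup_idem]
  have hvw : Submodule.span ℤ (Set.range (Sum.elim c (Sum.elim a b))) ≤
      Submodule.span ℤ (Set.range w) := by
    rw [hv, hw]
    exact sup_le (inf_le_inf_right _ fun x hx => Submodule.mem_sup_left hx)
      (inf_le_inf_right _ fun x hx => Submodule.mem_sup_right hx)
  have hZ : Function.Injective fun r : ℤ => r • (1 : ℝ) := fun x y h => by simpa using h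
  have hvi : LinearIndependent ℝ (Sum.elim c (Sum.elim a b)) := by
    refine (linearIndependent_sumElim_sumElim_int (hai.restrict_scalars hZ)
      (hbi.restrict_scalars hZ) ?_).real_of_int ?_
    · rw [ha, hb, hc]
      exact fun x hx => ⟨⟨hx.1.1, hx.2.1⟩, hx.1.2⟩
    · rw [hv]
      exact discreteTopology_of_le (sup_le inf_le_right inf_le_right)
  have hA' : Submodule.span ℝ (Set.range (Sum.elim c a)) = A := (hrat ha).symm.trans hA
  have hB' : Submodule.span ℝ (Set.range (Sum.elim c b)) = B := (hrat hb).symm.trans hB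
  have hw' : Submodule.span ℝ (Set.range w) = A ⊔ B := (hrat hw).symm.trans hsup
  have hv' : Submodule.span ℝ (Set.range (Sum.elim c (Sum.elim a b))) = A ⊔ B := by
    rw [← hA', ← hB']
    simp only [Set.Sum.elim_range, Submodule.span_union]
    rw [sup_sup_sup_comm, sup_idem]
  have hinf : Submodule.span ℝ
      (((A ⊓ B : Submodule ℝ (Fin d → ℝ)) : Set (Fin d → ℝ)) ∩ (Λ : Set (Fin d → ℝ))) =
      A ⊓ B := by
    refine Submodule.eq_of_le_of_finrank_eq (Submodule.span_le.2 Set.inter_subset_left) ?_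
    have h := Submodule.finrank_sup_add_finrank_inf_eq A B
    have h₁ := finrank_span_eq_card hai
    have h₂ := finrank_span_eq_card hbi
    have h₃ := finrank_span_eq_card hvi
    rw [hA'] at h₁
    rw [hB'] at h₂
    rw [hv'] at h₃
    rw [hrat hc, finrank_span_eq_card hci]
    simp only [Fintype.card_sum] at h₁ h₂ h₃
    omega
  refine ⟨hsup, hinf, ?_⟩
  have hcard := (finrank_span_eq_card hvi).symm.trans
    ((congrArg (fun M : Submodule ℝ (Fin d → ℝ) => Module.finrank ℝ M)
      (hv'.trans hw'.symm)).trans (finrank_span_eq_card hwi))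
  have hc0 : 0 ≤ gramDet c := hci.posDef_mul_transpose.det_pos.le
  have ha0 : 0 ≤ gramDet (Sum.elim c a) := hai.posDef_mul_transpose.det_pos.le
  have hw0 : 0 ≤ gramDet w := hwi.posDef_mul_transpose.det_pos.le
  rw [hlat hwi hw, hlat hci hc, hlat hai ha, hlat hbi hb, ← Real.sqrt_mul hw0,
    ← Real.sqrt_mul ha0]
  exact Real.sqrt_le_sqrt ((mul_le_mul_of_nonneg_right
    (gramDet_le_of_span_le hvi hcard hvw) hc0).trans (gramDet_mul_gramDet_le hvi))

end
end
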